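/- Let γ ∈ W^{1,∞}_{i,a}(𝕋, ℝ^n), q > 1 and p ∈ (2q, 4q−2]. Then for every w ∈ (0,1) one has G^{(p,q)}_w(γ) ≥ π^{p−q} sin(πw)^{2q−p}, and if moreover p < 2q+1, then G^{(p,q)}(γ) ≥ π^{p−q} ∫₀¹ sin(πw)^{2q−p} dw; in both inequalities equality holds if and only if the image of γ is a round circle. -/

import Mathlib

open MeasureTheory Real Set intervalIntegral
open scoped ENNReal RealInnerProductSpace

noncomputable section

/-- A closed `W^{1,1}`-curve on the torus `𝕋 = ℝ/ℤ` with values in `ℝⁿ`, encoded as a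
`1`-periodic absolutely continuous function `toFun : ℝ → ℝⁿ` together with its
(weak) derivative `deriv'`. -/
structure ClosedCurve (n : ℕ) where
  toFun : ℝ → EuclideanSpace ℝ (Fin n)
  deriv' : ℝ → EuclideanSpace ℝ (Fin n)
  periodic : Function.Periodic toFun 1
  deriv'_periodic : Function.Periodic deriv' 1
  integrableOn : MeasureTheory.IntegrableOn deriv' (Set.Icc (0:ℝ) 1)
  eq_integral : ∀ t : ℝ, toFun t = toFun 0 + ∫ s in (0:ℝ)..t, deriv' s

namespace ClosedCurve

variable {n : ℕ}

/-- Injectivity as a map on the torus `ℝ/ℤ`. -/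
def IsInj (γ : ClosedCurve n) : Prop :=
  ∀ s t : ℝ, γ.toFun s = γ.toFun t → ∃ k : ℤ, s - t = (k : ℝ)

/-- Regularity: the derivative does not vanish a.e. -/
def IsRegular (γ : ClosedCurve n) : Prop := ∀ᵐ t : ℝ ∂volume, γ.deriv' t ≠ 0

/-- Parametrization by arc length: `|γ'| = 1` a.e. -/
def IsArclength (γ : ClosedCurve n) : Prop := ∀ᵐ t : ℝ ∂volume, ‖γ.deriv' t‖ = 1

/-- The length of a closed curve. -/
def length (γ : ClosedCurve n) : ℝ := ∫ t in (0:ℝ)..1, ‖γ.deriv' t‖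

end ClosedCurve

/-- Orthogonal projection onto the orthogonal complement of `span {v}` (for `v ≠ 0`). -/
def projPerp {F : Type*} [NormedAddCommGroup F] [InnerProductSpace ℝ F] (v x : F) : F :=
  x - (⟪v, x⟫ / ‖v‖ ^ 2) • v

/-- The Gauss map `φ_γ(u,w)`: the unit secant direction. -/
def gaussMap {n : ℕ} (γ : ClosedCurve n) (u w : ℝ) : EuclideanSpace ℝ (Fin n) :=
  ‖γ.toFun (u + w) - γ.toFun u‖⁻¹ • (γ.toFun (u + w) - γ.toFun u)

/-- `|∂_u φ_γ(u,w)|`, expressed via the identity (1.8) of the paper. -/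
def gaussDerivU {n : ℕ} (γ : ClosedCurve n) (u w : ℝ) : ℝ :=
  ‖projPerp (gaussMap γ u w) (γ.deriv' (u + w) - γ.deriv' u)‖ /
    ‖γ.toFun (u + w) - γ.toFun u‖

/-- `|∂_w φ_γ(u,w)|`, expressed via the identity (1.7) of the paper. -/
def gaussDerivW {n : ℕ} (γ : ClosedCurve n) (u w : ℝ) : ℝ :=
  ‖projPerp (gaussMap γ u w) (γ.deriv' (u + w))‖ / ‖γ.toFun (u + w) - γ.toFun u‖

/-- The generalized tangent-point energy `TP^{(p,q)}` (with values in `[0,∞]`). -/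
def TP {n : ℕ} (p q : ℝ) (γ : ClosedCurve n) : ℝ≥0∞ :=
  ∫⁻ u in Set.Ioc (0:ℝ) 1, ∫⁻ w in Set.Ioc (0:ℝ) 1,
    ENNReal.ofReal
      (‖projPerp (γ.deriv' u) (γ.toFun (u + w) - γ.toFun u)‖ ^ q /
        ‖γ.toFun (u + w) - γ.toFun u‖ ^ p * (‖γ.deriv' u‖ * ‖γ.deriv' (u + w)‖))

/-- The minorant `G^{(p,q)}_w`. -/
def Gw {n : ℕ} (p q : ℝ) (γ : ClosedCurve n) (w : ℝ) : ℝ≥0∞ :=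
  ∫⁻ u in Set.Ioc (0:ℝ) 1,
    ENNReal.ofReal ((1/2 * gaussDerivU γ u w) ^ q *
      ‖γ.toFun (u + w) - γ.toFun u‖ ^ (2*q - p))

/-- The minorant `G^{(p,q)}`. -/
def G {n : ℕ} (p q : ℝ) (γ : ClosedCurve n) : ℝ≥0∞ :=
  ∫⁻ w in Set.Ioc (0:ℝ) 1, Gw p q γ w

/-- A round circle in a euclidean space: a sphere intersected with a 2-dimensional plane
through its center. -/
def IsCircle {F : Type*} [NormedAddCommGroup F] [InnerProductSpace ℝ F] (S : Set F) : Prop :=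
  ∃ (c : F) (r : ℝ) (V : Submodule ℝ F), 0 < r ∧ Module.finrank ℝ V = 2 ∧
    S = {x | ‖x - c‖ = r ∧ x - c ∈ V}

/-- A great circle of the unit sphere. -/
def IsGreatCircle {F : Type*} [NormedAddCommGroup F] [InnerProductSpace ℝ F]
    (S : Set F) : Prop :=
  ∃ V : Submodule ℝ F, Module.finrank ℝ V = 2 ∧ S = {x | ‖x‖ = 1 ∧ x ∈ V}

/-- Half of a great circle of the unit sphere: a great-circle arc of angular length `π`. -/
def IsHalfGreatCircle {F : Type*} [NormedAddCommGroup F] [InnerProductSpace ℝ F]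
    (S : Set F) : Prop :=
  ∃ a b : F, ‖a‖ = 1 ∧ ‖b‖ = 1 ∧ ⟪a, b⟫ = 0 ∧
    S = (fun t : ℝ => Real.cos t • a + Real.sin t • b) '' Set.Icc 0 π

/-- A curve is convex if its image is the boundary (within its affine hull) of a convex
planar (2-dimensional) set. -/
def ClosedCurve.IsConvex {n : ℕ} (γ : ClosedCurve n) : Prop :=
  ∃ K : Set (EuclideanSpace ℝ (Fin n)), Convex ℝ K ∧
    Module.finrank ℝ (affineSpan ℝ K).direction = 2 ∧
    Set.range γ.toFun = intrinsicFrontier ℝ K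

theorem abs_sin_nat_mul_le (n : ℕ) (x : ℝ) : |sin (n * x)| ≤ n * |sin x| := by
  induction n with
  | zero => simp
  | succ n ih =>
    have h : sin ((n + 1 : ℕ) * x) = sin (n * x) * cos x + cos (n * x) * sin x := by
      rw [← sin_add]; push_cast; ring_nf
    rw [h]
    calc _ ≤ |sin (n * x) * cos x| + |cos (n * x) * sin x| := abs_add_le _ _
      _ = |sin (n * x)| * |cos x| + |cos (n * x)| * |sin x| := by rw [abs_mul, abs_mul]
      _ ≤ |sin (n * x)| * 1 + 1 * |sin x| := by
        gcongr
        · exact abs_cos_le_one _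
        · exact abs_cos_le_one _
      _ ≤ _ := by push_cast; linarith

theorem abs_sin_nat_mul_lt {n : ℕ} (hn : 2 ≤ n) {x : ℝ} (hx : sin x ≠ 0) :
    |sin (n * x)| < n * |sin x| := by
  obtain ⟨m, rfl⟩ : ∃ m, n = m + 1 := ⟨n - 1, by omega⟩
  have hm : (1 : ℝ) ≤ m := by exact_mod_cast (by omega : 1 ≤ m)
  have h : sin ((m + 1 : ℕ) * x) = sin (m * x) * cos x + cos (m * x) * sin x := by
    rw [← sin_add]; push_cast; ring_nf
  have hs : 0 < |sin x| := abs_pos.2 hx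
  have hc : |cos x| < 1 := by
    rw [← sq_lt_one_iff_abs_lt_one]
    have := sin_sq_add_cos_sq x
    have : 0 < sin x ^ 2 := by positivity
    linarith
  rw [h]
  calc _ ≤ |sin (m * x) * cos x| + |cos (m * x) * sin x| := abs_add_le _ _
    _ = |sin (m * x)| * |cos x| + |cos (m * x)| * |sin x| := by rw [abs_mul, abs_mul]
    _ ≤ (m * |sin x|) * |cos x| + 1 * |sin x| := by
      gcongr
      · exact abs_sin_nat_mul_le _ _
      · exact abs_cos_le_one _
    _ < (m * |sin x|) * 1 + 1 * |sin x| := by gcongr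
    _ = _ := by push_cast; ring

theorem sin_int_mul_sq (n : ℤ) (x : ℝ) : sin (n * x) ^ 2 = |sin (n.natAbs * x)| ^ 2 := by
  rw [sq_abs]
  rw [Nat.cast_natAbs, Int.cast_abs]
  rcases abs_choice (n : ℝ) with h | h <;> rw [h]
  rw [neg_mul, sin_neg, neg_sq]

theorem int_cast_sq_eq_natAbs (n : ℤ) : ((n : ℝ)) ^ 2 = (n.natAbs : ℝ) ^ 2 := by
  rw [Nat.cast_natAbs, Int.cast_abs, sq_abs]

theorem sin_int_mul_sq_le (n : ℤ) (x : ℝ) : sin (n * x) ^ 2 ≤ n ^ 2 * sin x ^ 2 := by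
  rw [sin_int_mul_sq, int_cast_sq_eq_natAbs, ← sq_abs (sin x), ← mul_pow]
  gcongr
  exact abs_sin_nat_mul_le _ _

theorem sin_int_mul_sq_lt {n : ℤ} (hn : 2 ≤ n.natAbs) {x : ℝ} (hx : sin x ≠ 0) :
    sin (n * x) ^ 2 < n ^ 2 * sin x ^ 2 := by
  rw [sin_int_mul_sq, int_cast_sq_eq_natAbs, ← sq_abs (sin x), ← mul_pow]
  gcongr
  exact abs_sin_nat_mul_lt hn hx

theorem fourierCoeff_translate (F : UnitAddCircle → ℂ) (a : UnitAddCircle) (n : ℤ) :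
    fourierCoeff (fun x => F (x + a)) n = fourier n a * fourierCoeff F n := by
  unfold fourierCoeff
  rw [← integral_add_right_eq_self (fun x => fourier (-n) x • F x) a,
    ← MeasureTheory.integral_const_mul]
  congr 1
  ext x
  have h1 : (fourier (-n) (x + a) : ℂ) = fourier (-n) x * fourier (-n) a := by
    rw [fourier_apply, fourier_apply, fourier_apply, smul_add, AddCircle.toCircle_add,
      Circle.coe_mul]
  have h2 : (fourier n a : ℂ) * fourier (-n) a = 1 := by
    rw [← fourier_add]; simp
  rw [h1, smul_eq_mul, smul_eq_mul]
  linear_combination (-(fourier (-n) x : ℂ) * F (x + a)) * h2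

theorem norm_fourier_sub_one_sq (n : ℤ) (w : ℝ) :
    ‖(fourier n (w : UnitAddCircle) : ℂ) - 1‖ ^ 2 = 4 * sin (π * n * w) ^ 2 := by
  have h : (fourier n (w : UnitAddCircle) : ℂ) =
      Complex.exp (Complex.I * ((2 * π * n * w : ℝ) : ℂ)) := by
    rw [fourier_coe_apply]
    congr 1
    push_cast
    simp
    ring
  rw [h, Complex.norm_exp_I_mul_ofReal_sub_one, norm_mul, mul_pow]
  simp only [norm_eq_abs, sq_abs]
  norm_num
  ring_nf

theorem hasSum_fourierCoeff_chord (F : C(UnitAddCircle, ℂ)) (w : ℝ) :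
    HasSum (fun n : ℤ => 4 * sin (π * n * w) ^ 2 * ‖fourierCoeff F n‖ ^ 2)
      (∫ u in (0:ℝ)..1, ‖F ((u + w : ℝ) : UnitAddCircle) - F (u : UnitAddCircle)‖ ^ 2) := by
  let D : C(UnitAddCircle, ℂ) :=
    ⟨fun x => F (x + (w : UnitAddCircle)) - F x, by fun_prop⟩
  have h := hasSum_sq_fourierCoeff (ContinuousMap.toLp (E := ℂ) 2 AddCircle.haarAddCircle ℂ D)
  have hint : ∀ G : C(UnitAddCircle, ℂ), Integrable G AddCircle.haarAddCircle := fun G =>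
    G.continuous.integrable_of_hasCompactSupport (HasCompactSupport.of_compactSpace _)
  convert! h using 1
  · ext n
    rw [fourierCoeff_toLp]
    have hD : fourierCoeff D n = ((fourier n (w : UnitAddCircle) : ℂ) - 1) * fourierCoeff F n := by
      rw [sub_mul, one_mul, ← fourierCoeff_translate]
      simp only [fourierCoeff]
      rw [← MeasureTheory.integral_sub]
      · congr 1; ext x; simp [D, mul_sub]
      · exact (hint ⟨fun x => F (x + (w : UnitAddCircle)), by fun_prop⟩).fourier_smul (-n)
      · exact (hint F).fourier_smul (-n)
    rw [hD, norm_mul, mul_pow, norm_fourier_sub_one_sq]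
  · have h2 : ∫ t, ‖(ContinuousMap.toLp (E := ℂ) 2 AddCircle.haarAddCircle ℂ D) t‖ ^ 2
        ∂AddCircle.haarAddCircle = ∫ t : UnitAddCircle, ‖D t‖ ^ 2 := by
      rw [AddCircle.volume_eq_smul_haarAddCircle, ENNReal.ofReal_one, one_smul]
      apply MeasureTheory.integral_congr_ae
      filter_upwards [ContinuousMap.coeFn_toLp (p := 2) (𝕜 := ℂ) AddCircle.haarAddCircle D]
        with t ht
      rw [ht]
    rw [h2, ← UnitAddCircle.intervalIntegral_preimage 0]
    simp [D]

/-- Wirtinger type inequality for the Fourier weights of a Lipschitz curve. -/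
theorem chord_weights_bound {E : ℤ → ℝ} {A : ℝ → ℝ} (hE : ∀ n, 0 ≤ E n)
    (hA : ∀ w, HasSum (fun n : ℤ => 4 * sin (π * n * w) ^ 2 * E n) (A w))
    (hlip : ∀ w, A w ≤ w ^ 2) :
    Summable (fun n : ℤ => 4 * π ^ 2 * n ^ 2 * E n) ∧
      ∑' n : ℤ, 4 * π ^ 2 * n ^ 2 * E n ≤ 1 := by
  have key : ∀ s : Finset ℤ, ∑ n ∈ s, 4 * π ^ 2 * n ^ 2 * E n ≤ 1 := by
    intro s
    have hlim : Filter.Tendsto (fun h : ℝ => ∑ n ∈ s, 4 * (h⁻¹ * sin (π * n * h)) ^ 2 * E n)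
        (nhdsWithin 0 {0}ᶜ) (nhds (∑ n ∈ s, 4 * (π * n) ^ 2 * E n)) := by
      apply tendsto_finsetSum
      intro n _
      have hd : HasDerivAt (fun h : ℝ => sin (π * n * h)) (π * n) 0 := by
        have := ((hasDerivAt_id (0:ℝ)).const_mul (π * n)).sin
        simpa using this
      have := hd.tendsto_slope_zero
      simp only [zero_add, mul_zero, sin_zero, sub_zero, smul_eq_mul] at this
      exact ((this.pow 2).const_mul 4).mul_const _
    have hle := le_of_tendsto hlim (b := 1) (by
      filter_upwards [self_mem_nhdsWithin] with h hh
      have hh : h ≠ 0 := hh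
      have h1 : ∑ n ∈ s, 4 * sin (π * n * h) ^ 2 * E n ≤ A h :=
        sum_le_hasSum s (fun n _ => by have := hE n; positivity) (hA h)
      have h2 : ∑ n ∈ s, 4 * (h⁻¹ * sin (π * n * h)) ^ 2 * E n =
          (h ^ 2)⁻¹ * ∑ n ∈ s, 4 * sin (π * n * h) ^ 2 * E n := by
        rw [Finset.mul_sum]
        refine Finset.sum_congr rfl fun n _ => ?_
        ring
      rw [h2, inv_mul_le_iff₀ (by positivity), mul_one]
      exact h1.trans (hlip h))
    refine le_trans (le_of_eq (Finset.sum_congr rfl fun n _ => ?_)) hle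
    ring
  have hnn : ∀ n : ℤ, 0 ≤ 4 * π ^ 2 * n ^ 2 * E n := fun n => by have := hE n; positivity
  have hs := summable_of_sum_le hnn key
  exact ⟨hs, hs.tsum_le_of_sum_le key⟩

theorem chord_le {E : ℤ → ℝ} {A : ℝ → ℝ} (hE : ∀ n, 0 ≤ E n)
    (hA : ∀ w, HasSum (fun n : ℤ => 4 * sin (π * n * w) ^ 2 * E n) (A w))
    (hlip : ∀ w, A w ≤ w ^ 2) (w : ℝ) : A w ≤ sin (π * w) ^ 2 / π ^ 2 := by
  obtain ⟨hs, h1⟩ := chord_weights_bound hE hA hlip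
  have h2 : HasSum (fun n : ℤ => sin (π * w) ^ 2 / π ^ 2 * (4 * π ^ 2 * n ^ 2 * E n)) _ :=
    hs.hasSum.mul_left (sin (π * w) ^ 2 / π ^ 2)
  refine (hasSum_le (fun n => ?_) (hA w) h2).trans
    (mul_le_of_le_one_right (by positivity) h1)
  have h3 := mul_le_mul_of_nonneg_right (sin_int_mul_sq_le n (π * w)) (hE n)
  have h4 : sin (π * w) ^ 2 / π ^ 2 * (4 * π ^ 2 * n ^ 2 * E n)
      = 4 * (n ^ 2 * sin (π * w) ^ 2 * E n) := by field_simp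
  have h5 : π * n * w = n * (π * w) := by ring
  rw [h4, h5]
  linarith

theorem chord_eq {E : ℤ → ℝ} {A : ℝ → ℝ} (hE : ∀ n, 0 ≤ E n)
    (hA : ∀ w, HasSum (fun n : ℤ => 4 * sin (π * n * w) ^ 2 * E n) (A w))
    (hlip : ∀ w, A w ≤ w ^ 2) {w : ℝ} (hw : sin (π * w) ≠ 0)
    (heq : sin (π * w) ^ 2 / π ^ 2 ≤ A w) {n : ℤ} (hn : 2 ≤ n.natAbs) : E n = 0 := by
  obtain ⟨hs, h1⟩ := chord_weights_bound hE hA hlip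
  have h2 : HasSum (fun n : ℤ => sin (π * w) ^ 2 / π ^ 2 * (4 * π ^ 2 * n ^ 2 * E n)) _ :=
    hs.hasSum.mul_left (sin (π * w) ^ 2 / π ^ 2)
  have h4 : ∀ n : ℤ, sin (π * w) ^ 2 / π ^ 2 * (4 * π ^ 2 * n ^ 2 * E n)
      = 4 * (n ^ 2 * sin (π * w) ^ 2 * E n) := fun n => by field_simp
  have h5 : ∀ n : ℤ, π * n * w = n * (π * w) := fun n => by ring
  by_contra hne
  have hpos : 0 < E n := lt_of_le_of_ne (hE n) (Ne.symm hne)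
  have hlt := hasSum_lt (fun n => ?_) (i := n) ?_ (hA w) h2
  · have := mul_le_of_le_one_right (a := sin (π * w) ^ 2 / π ^ 2) (by positivity) h1
    linarith
  · have h3 := mul_le_mul_of_nonneg_right (sin_int_mul_sq_le n (π * w)) (hE n)
    rw [h4, h5]
    linarith
  · have h3 := mul_lt_mul_of_pos_right (sin_int_mul_sq_lt hn hw) hpos
    rw [h4, h5]
    linarith

theorem le_sin_add_cube {y : ℝ} (h0 : 0 ≤ y) (h1 : y ≤ π / 2) :
    y ≤ sin y + 100 * sin y ^ 3 := by
  rcases h0.eq_or_lt with rfl | h0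
  · simp
  have hs : 2 / π * y ≤ sin y := mul_le_sin h0.le h1
  have hs' : y / 2 ≤ sin y := by
    refine le_trans ?_ hs
    rw [div_mul_eq_mul_div, div_le_div_iff₀ (by norm_num) pi_pos]
    nlinarith [pi_le_four]
  rcases le_or_gt y 1 with hy | hy
  · have h2 := sin_gt_sub_cube h0
    have h3 : (y / 2) ^ 3 ≤ sin y ^ 3 := by gcongr
    have h4 : 0 < y ^ 3 := by positivity
    nlinarith
  · have h3 : (1 / 2) ^ 3 ≤ sin y ^ 3 := by
      gcongr
      linarith
    have : y ≤ 2 := by linarith [pi_le_four]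
    nlinarith

section SphericalCurve

variable {V : Type*} [NormedAddCommGroup V] [InnerProductSpace ℝ V]

open InnerProductGeometry

theorem norm_sub_eq_two_mul_sin_half_angle {x y : V} (hx : ‖x‖ = 1) (hy : ‖y‖ = 1) :
    ‖x - y‖ = 2 * sin (angle x y / 2) := by
  have h0 := angle_nonneg x y
  have h1 := angle_le_pi x y
  have h2 : 0 ≤ sin (angle x y / 2) := sin_nonneg_of_nonneg_of_le_pi (by linarith) (by linarith)
  rw [← sq_eq_sq₀ (norm_nonneg _) (by positivity), norm_sub_sq_real, hx, hy, mul_pow,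
    sin_sq_eq_half_sub]
  have h3 := cos_angle_mul_norm_mul_norm x y
  rw [hx, hy] at h3
  rw [← h3, mul_div_cancel₀ _ (two_ne_zero)]
  ring

theorem angle_le_norm_sub_add_cube {x y : V} (hx : ‖x‖ = 1) (hy : ‖y‖ = 1) :
    angle x y ≤ ‖x - y‖ + 25 * ‖x - y‖ ^ 3 := by
  have h0 := angle_nonneg x y
  have h1 := angle_le_pi x y
  rw [norm_sub_eq_two_mul_sin_half_angle hx hy]
  have := le_sin_add_cube (y := angle x y / 2) (by linarith) (by linarith)
  nlinarith

theorem angle_le_integral {φ : ℝ → V} {g : ℝ → ℝ} (hφ : ∀ u, ‖φ u‖ = 1)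
    (hg : ∀ a b, IntervalIntegrable g volume a b)
    (hchord : ∀ s t, s ≤ t → ‖φ t - φ s‖ ≤ ∫ u in s..t, g u) {s t : ℝ} (hst : s ≤ t) :
    angle (φ s) (φ t) ≤ ∫ u in s..t, g u := by
  have hnn : ∀ s t, s ≤ t → 0 ≤ ∫ u in s..t, g u := fun s t h =>
    (norm_nonneg _).trans (hchord s t h)
  have key : ∀ (k : ℕ) (s t : ℝ), s ≤ t → angle (φ s) (φ t) ≤
      (∫ u in s..t, g u) + 25 * (∫ u in s..t, g u) ^ 3 * (1 / 4) ^ k := by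
    intro k
    induction k with
    | zero =>
      intro s t h
      have h1 := hchord s t h
      rw [norm_sub_rev] at h1
      have h2 := angle_le_norm_sub_add_cube (hφ s) (hφ t)
      rw [pow_zero, mul_one]
      refine h2.trans ?_
      gcongr
    | succ k ih =>
      intro s t h
      obtain ⟨m, hm, hm'⟩ : (∫ u in s..t, g u) / 2 ∈ (fun m => ∫ u in s..m, g u) '' Icc s t := by
        apply intermediate_value_Icc h (continuous_primitive hg s).continuousOn
        have := hnn s t h
        simp only [integral_same]
        constructor <;> linarith
      have h1 : ∫ u in m..t, g u = (∫ u in s..t, g u) / 2 := by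
        have := integral_add_adjacent_intervals (hg s m) (hg m t)
        simp only at hm'
        linarith
      have h2 := ih s m hm.1
      have h3 := ih m t hm.2
      simp only at hm'
      rw [hm'] at h2
      rw [h1] at h3
      have h4 := angle_le_angle_add_angle (φ s) (φ m) (φ t)
      rw [pow_succ (1 / 4 : ℝ) k]
      linarith
  have hlim : Filter.Tendsto (fun k : ℕ =>
      (∫ u in s..t, g u) + 25 * (∫ u in s..t, g u) ^ 3 * (1 / 4 : ℝ) ^ k) Filter.atTop
      (nhds ((∫ u in s..t, g u) + 25 * (∫ u in s..t, g u) ^ 3 * 0)) :=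
    ((tendsto_pow_atTop_nhds_zero_of_lt_one (by norm_num) (by norm_num)).const_mul _).const_add _
  simpa using ge_of_tendsto' hlim fun k => key k s t hst

theorem inner_add_pos_of_angle_add_lt_pi {x y z : V} (hx : ‖x‖ = 1) (hy : ‖y‖ = 1) (hz : ‖z‖ = 1)
    (h : angle x y + angle y z < π) : 0 < ⟪x + z, y⟫ := by
  have h1 := cos_angle_mul_norm_mul_norm x y
  have h2 := cos_angle_mul_norm_mul_norm y z
  rw [hx, hy] at h1
  rw [hy, hz, real_inner_comm] at h2
  rw [inner_add_left, ← h1, ← h2]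
  have h3 : cos (π - angle x y) < cos (angle y z) := by
    apply cos_lt_cos_of_nonneg_of_le_pi (angle_nonneg _ _)
    · linarith [angle_nonneg x y]
    · linarith
  rw [cos_pi_sub] at h3
  linarith

/-- **Fenchel's theorem** for spherical curves: a closed curve on the unit sphere having the
origin as a weighted mean with positive weights has length at least `2π`. -/
theorem two_pi_le_integral_of_balanced [CompleteSpace V] {φ : ℝ → V} {g m : ℝ → ℝ}
    (hφ : ∀ u, ‖φ u‖ = 1) (hclosed : φ 1 = φ 0) (hφc : Continuous φ)
    (hg : ∀ a b, IntervalIntegrable g volume a b)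
    (hchord : ∀ s t, s ≤ t → ‖φ t - φ s‖ ≤ ∫ u in s..t, g u)
    (hm : ∀ u, 0 < m u) (hmc : Continuous m) (hbal : ∫ u in (0:ℝ)..1, m u • φ u = 0) :
    2 * π ≤ ∫ u in (0:ℝ)..1, g u := by
  by_contra! hlt
  have hnn : 0 ≤ ∫ u in (0:ℝ)..1, g u := (norm_nonneg _).trans (hchord 0 1 zero_le_one)
  obtain ⟨c, hc, hc'⟩ : (∫ u in (0:ℝ)..1, g u) / 2 ∈
      (fun c => ∫ u in (0:ℝ)..c, g u) '' Icc 0 1 := by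
    apply intermediate_value_Icc zero_le_one (continuous_primitive hg 0).continuousOn
    simp only [integral_same]
    constructor <;> linarith
  simp only at hc'
  have hc'' := integral_add_adjacent_intervals (hg 0 c) (hg c 1)
  have hpos : ∀ u ∈ Ioo (0:ℝ) 1, 0 < m u * ⟪φ 0 + φ c, φ u⟫ := by
    intro u hu
    refine mul_pos (hm u) ?_
    rcases le_total u c with h | h
    · apply inner_add_pos_of_angle_add_lt_pi (hφ _) (hφ _) (hφ _)
      have h1 := angle_le_integral hφ hg hchord hu.1.le
      have h2 := angle_le_integral hφ hg hchord h
      have := integral_add_adjacent_intervals (hg 0 u) (hg u c)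
      linarith
    · rw [add_comm]
      apply inner_add_pos_of_angle_add_lt_pi (hφ _) (hφ _) (hφ _)
      have h1 := angle_le_integral hφ hg hchord h
      have h2 := angle_le_integral hφ hg hchord hu.2.le
      have := integral_add_adjacent_intervals (hg c u) (hg u 1)
      rw [hclosed] at h2
      linarith
  have hI := intervalIntegral_pos_of_pos_on (Continuous.intervalIntegrable (by fun_prop) 0 1)
    hpos zero_lt_one
  have h2 : ∫ u in (0:ℝ)..1, m u * ⟪φ 0 + φ c, φ u⟫ = ⟪φ 0 + φ c, ∫ u in (0:ℝ)..1, m u • φ u⟫ := by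
    have h3 := (innerSL ℝ (φ 0 + φ c)).intervalIntegral_comp_comm
      (Continuous.intervalIntegrable (u := fun u => m u • φ u) (μ := volume) (by fun_prop) 0 1)
    simp only [innerSL_apply_apply, inner_smul_right] at h3
    exact h3
  rw [h2, hbal, inner_zero_right] at hI
  exact lt_irrefl _ hI

end SphericalCurve

theorem convex_tangent_bound {q β s t : ℝ} (hq : 1 < q) (hβ : 0 ≤ β) (hβq : β ≤ q - 1)
    (hs : 0 ≤ s) (ht : 0 < t) :
    1 + q * (s - 1) - β * (t - 1) ≤ s ^ q * t ^ (-β) := by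
  have hq0 : 0 < q := by linarith
  have h := geom_mean_le_arith_mean3_weighted (w₁ := 1 / q) (w₂ := β / q) (w₃ := (q - 1 - β) / q)
    (p₁ := s ^ q * t ^ (-β)) (p₂ := t) (p₃ := 1)
    (by positivity) (by positivity) (div_nonneg (by linarith) hq0.le)
    (by positivity) ht.le zero_le_one (by field_simp; ring)
  have h1 : (s ^ q * t ^ (-β)) ^ (1 / q) * t ^ (β / q) * 1 ^ ((q - 1 - β) / q) = s := by
    rw [one_rpow, mul_one, mul_rpow (by positivity) (by positivity), ← rpow_mul hs,
      ← rpow_mul ht.le, mul_assoc, ← rpow_add ht]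
    have : -β * (1 / q) + β / q = 0 := by ring
    rw [this, rpow_zero, mul_one_div_cancel hq0.ne', rpow_one, mul_one]
  rw [h1] at h
  have h2 := mul_le_mul_of_nonneg_left h hq0.le
  have h3 : q * (1 / q * (s ^ q * t ^ (-β)) + β / q * t + (q - 1 - β) / q * 1)
      = s ^ q * t ^ (-β) + β * t + (q - 1 - β) := by field_simp
  rw [h3] at h2
  linarith

namespace ClosedCurve

variable {n : ℕ} {γ : ClosedCurve n}

theorem intervalIntegrable_deriv' (γ : ClosedCurve n) (a b : ℝ) :
    IntervalIntegrable γ.deriv' volume a b := by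
  refine γ.deriv'_periodic.intervalIntegrable₀ one_ne_zero ?_ a b
  rw [intervalIntegrable_iff_integrableOn_Icc_of_le zero_le_one]
  exact γ.integrableOn

theorem locallyIntegrable_deriv' (γ : ClosedCurve n) : LocallyIntegrable γ.deriv' volume := by
  intro x
  refine ⟨Icc (x - 1) (x + 1), Icc_mem_nhds (by linarith) (by linarith), ?_⟩
  rw [← intervalIntegrable_iff_integrableOn_Icc_of_le (by linarith)]
  exact γ.intervalIntegrable_deriv' _ _

theorem ae_hasDerivAt (γ : ClosedCurve n) : ∀ᵐ u : ℝ, HasDerivAt γ.toFun (γ.deriv' u) u := by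
  filter_upwards [LocallyIntegrable.ae_hasDerivAt_integral γ.locallyIntegrable_deriv'] with u hu
  have h : γ.toFun = fun t => γ.toFun 0 + ∫ s in (0:ℝ)..t, γ.deriv' s := funext γ.eq_integral
  rw [h]
  exact (hu 0).const_add _

theorem sub_eq_integral (γ : ClosedCurve n) (s t : ℝ) :
    γ.toFun t - γ.toFun s = ∫ u in s..t, γ.deriv' u := by
  rw [γ.eq_integral t, γ.eq_integral s, add_sub_add_left_eq_sub]
  exact integral_interval_sub_left (γ.intervalIntegrable_deriv' _ _)
    (γ.intervalIntegrable_deriv' _ _)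

theorem IsArclength.norm_sub_le (h : γ.IsArclength) (s t : ℝ) :
    ‖γ.toFun t - γ.toFun s‖ ≤ |t - s| := by
  rw [γ.sub_eq_integral]
  have := norm_integral_le_of_norm_le_const_ae (a := s) (b := t) (C := 1) (f := γ.deriv')
    (by filter_upwards [h] with u hu _ using hu.le)
  simpa using this

theorem IsArclength.lipschitzWith (h : γ.IsArclength) : LipschitzWith 1 γ.toFun :=
  LipschitzWith.of_dist_le_mul fun s t => by
    rw [dist_eq_norm, dist_eq_norm, NNReal.coe_one, one_mul]
    exact h.norm_sub_le t s

theorem IsArclength.continuous (h : γ.IsArclength) : Continuous γ.toFun :=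
  h.lipschitzWith.continuous

theorem IsInj.sub_ne_zero (h : γ.IsInj) {w : ℝ} (hw : w ∈ Ioo (0:ℝ) 1) (u : ℝ) :
    γ.toFun (u + w) - γ.toFun u ≠ 0 := by
  intro h0
  obtain ⟨k, hk⟩ := h _ _ (sub_eq_zero.1 h0)
  rw [add_sub_cancel_left] at hk
  have h1 : (0:ℝ) < k := hk ▸ hw.1
  have h2 : (k:ℝ) < 1 := hk ▸ hw.2
  have h1' : 0 < k := by exact_mod_cast h1
  have h2' : k < 1 := by exact_mod_cast h2
  omega

theorem periodic_chord (γ : ClosedCurve n) (w : ℝ) :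
    Function.Periodic (fun u => γ.toFun (u + w) - γ.toFun u) 1 := by
  intro u
  change γ.toFun (u + 1 + w) - γ.toFun (u + 1) = _
  rw [γ.periodic u, add_right_comm, γ.periodic (u + w)]

theorem exists_pos_le_chord (hinj : γ.IsInj) (harc : γ.IsArclength) {w : ℝ}
    (hw : w ∈ Ioo (0:ℝ) 1) : ∃ δ > 0, ∀ u, δ ≤ ‖γ.toFun (u + w) - γ.toFun u‖ := by
  have hc := harc.continuous
  obtain ⟨u₀, -, hu₀⟩ := isCompact_Icc.exists_isMinOn (nonempty_Icc.2 (zero_le_one' ℝ))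
    (f := fun u => ‖γ.toFun (u + w) - γ.toFun u‖) (Continuous.continuousOn (by fun_prop))
  refine ⟨_, norm_pos_iff.2 (hinj.sub_ne_zero hw u₀), fun u => ?_⟩
  obtain ⟨v, hv, hv'⟩ := (γ.periodic_chord w).exists_mem_Ico₀ zero_lt_one u
  rw [hv']
  exact hu₀ (Ico_subset_Icc_self hv)

/-- The mean square chord length of a closed curve. -/
def chordSq (γ : ClosedCurve n) (w : ℝ) : ℝ :=
  ∫ u in (0:ℝ)..1, ‖γ.toFun (u + w) - γ.toFun u‖ ^ 2

theorem IsArclength.continuous_chordSq (h : γ.IsArclength) : Continuous γ.chordSq := by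
  have hc := h.continuous
  unfold chordSq
  exact intervalIntegral.continuous_parametric_intervalIntegral_of_continuous' (by fun_prop) 0 1

theorem IsArclength.chordSq_le_sq (h : γ.IsArclength) (w : ℝ) : γ.chordSq w ≤ w ^ 2 := by
  have hc := h.continuous
  have h1 : γ.chordSq w ≤ ∫ u in (0:ℝ)..1, w ^ 2 := by
    apply integral_mono_on zero_le_one (Continuous.intervalIntegrable (by fun_prop) 0 1)
      (Continuous.intervalIntegrable (by fun_prop) 0 1)
    intro u _
    rw [← sq_abs w]
    have := h.norm_sub_le u (u + w)
    rw [add_sub_cancel_left] at this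
    gcongr
  simpa using h1

/-- A coordinate of a closed curve as a complex-valued function on the circle. -/
def coordFun (γ : ClosedCurve n) (hc : Continuous γ.toFun) (i : Fin n) : C(UnitAddCircle, ℂ) where
  toFun := fun x => ((γ.periodic.lift x i : ℝ) : ℂ)
  continuous_toFun := by
    refine (QuotientAddGroup.isQuotientMap_mk
      (N := AddSubgroup.zmultiples (1:ℝ))).continuous_iff.2 ?_
    change Continuous fun u : ℝ => ((γ.toFun u i : ℝ) : ℂ)
    fun_prop

theorem coordFun_coe (hc : Continuous γ.toFun) (i : Fin n) (u : ℝ) :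
    γ.coordFun hc i (u : UnitAddCircle) = ((γ.toFun u i : ℝ) : ℂ) := rfl

/-- The total weight of the `k`-th Fourier mode of a closed curve. -/
def modeWeight (γ : ClosedCurve n) (hc : Continuous γ.toFun) (k : ℤ) : ℝ :=
  ∑ i, ‖fourierCoeff (γ.coordFun hc i) k‖ ^ 2

theorem modeWeight_nonneg (hc : Continuous γ.toFun) (k : ℤ) : 0 ≤ γ.modeWeight hc k :=
  Finset.sum_nonneg fun _ _ => by positivity

theorem hasSum_modeWeight (hc : Continuous γ.toFun) (w : ℝ) :
    HasSum (fun k : ℤ => 4 * sin (π * k * w) ^ 2 * γ.modeWeight hc k) (γ.chordSq w) := by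
  have h := hasSum_sum (s := Finset.univ) fun i _ =>
    hasSum_fourierCoeff_chord (γ.coordFun hc i) w
  convert! h using 1
  · ext k
    rw [modeWeight, Finset.mul_sum]
  · rw [← intervalIntegral.integral_finsetSum]
    · unfold chordSq
      congr 1
      ext u
      rw [EuclideanSpace.norm_sq_eq]
      refine Finset.sum_congr rfl fun i _ => ?_
      rw [coordFun_coe, coordFun_coe, ← Complex.ofReal_sub, Complex.norm_real]
      rfl
    · intro i _
      simp only [coordFun_coe]
      exact Continuous.intervalIntegrable (by fun_prop) 0 1

theorem IsArclength.chordSq_le (h : γ.IsArclength) (w : ℝ) :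
    γ.chordSq w ≤ sin (π * w) ^ 2 / π ^ 2 :=
  chord_le (modeWeight_nonneg h.continuous) (hasSum_modeWeight h.continuous) h.chordSq_le_sq w

theorem IsArclength.exists_trig_of_le_chordSq (h : γ.IsArclength) {w : ℝ}
    (hw : sin (π * w) ≠ 0) (heq : sin (π * w) ^ 2 / π ^ 2 ≤ γ.chordSq w) :
    ∃ c a b : EuclideanSpace ℝ (Fin n),
      ∀ u, γ.toFun u = c + cos (2 * π * u) • a + sin (2 * π * u) • b := by
  have hc := h.continuous
  have h0 : ∀ i (k : ℤ), 2 ≤ k.natAbs → fourierCoeff (γ.coordFun hc i) k = 0 := by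
    intro i k hk
    have := chord_eq (modeWeight_nonneg hc) (hasSum_modeWeight hc) h.chordSq_le_sq hw heq hk
    have := (Finset.sum_eq_zero_iff_of_nonneg fun _ _ => by positivity).1 this i (Finset.mem_univ i)
    simpa using this
  have hsupp : ∀ i, ∀ k ∉ ({-1, 0, 1} : Finset ℤ), fourierCoeff (γ.coordFun hc i) k = 0 := by
    intro i k hk
    apply h0
    simp only [Finset.mem_insert, Finset.mem_singleton, not_or] at hk
    omega
  let f := fun i => fourierCoeff (γ.coordFun hc i)
  refine ⟨WithLp.toLp 2 fun i => (f i 0).re, WithLp.toLp 2 fun i => (f i 1).re + (f i (-1)).re,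
    WithLp.toLp 2 fun i => (f i (-1)).im - (f i 1).im, fun u => ?_⟩
  ext i
  have h1 := has_pointwise_sum_fourier_series_of_summable
    (summable_of_ne_finset_zero (hsupp i)) (u : UnitAddCircle)
  have h2 := hasSum_sum_of_ne_finset_zero (L := .unconditional ℤ) (s := ({-1, 0, 1} : Finset ℤ))
    (f := fun k => fourierCoeff (γ.coordFun hc i) k • (fourier k (u : UnitAddCircle) : ℂ))
    fun k hk => by rw [hsupp i k hk, zero_smul]
  have h3 := HasSum.unique h1 h2
  have he : ∀ k : ℤ, (fourier k (u : UnitAddCircle) : ℂ)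
      = ((cos (2 * π * k * u) : ℝ) : ℂ) + ((sin (2 * π * k * u) : ℝ) : ℂ) * Complex.I := by
    intro k
    rw [fourier_coe_apply, Complex.ofReal_cos, Complex.ofReal_sin, ← Complex.exp_mul_I]
    congr 1
    push_cast
    simp
    ring
  rw [coordFun_coe] at h3
  have h4 := congrArg Complex.re h3
  rw [Finset.sum_insert (by decide), Finset.sum_insert (by decide), Finset.sum_singleton] at h4
  have hre : ∀ k : ℤ, (fourier k (u : UnitAddCircle) : ℂ).re = cos (2 * π * k * u) := by
    intro k
    rw [he, Complex.add_re, Complex.ofReal_re, Complex.re_ofReal_mul, Complex.I_re, mul_zero,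
      add_zero]
  have him : ∀ k : ℤ, (fourier k (u : UnitAddCircle) : ℂ).im = sin (2 * π * k * u) := by
    intro k
    rw [he, Complex.add_im, Complex.ofReal_im, Complex.im_ofReal_mul, Complex.I_im, mul_one,
      zero_add]
  simp only [smul_eq_mul, Complex.add_re, Complex.mul_re, hre, him, Complex.ofReal_re] at h4
  have hneg : 2 * π * ((-1 : ℤ) : ℝ) * u = -(2 * π * u) := by push_cast; ring
  have hzero : 2 * π * ((0 : ℤ) : ℝ) * u = 0 := by push_cast; ring
  have hone : 2 * π * ((1 : ℤ) : ℝ) * u = 2 * π * u := by push_cast; ring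
  rw [hneg, hzero, hone, cos_neg, sin_neg, cos_zero, sin_zero] at h4
  simp only [PiLp.add_apply, PiLp.smul_apply, smul_eq_mul, f]
  rw [h4]
  ring

end ClosedCurve

section NormalizedCurve

variable {F : Type*} [NormedAddCommGroup F] [InnerProductSpace ℝ F]

theorem norm_projPerp_le (v x : F) : ‖projPerp v x‖ ≤ 2 * ‖x‖ := by
  have h : ‖(⟪v, x⟫ / ‖v‖ ^ 2) • v‖ ≤ ‖x‖ := by
    rcases eq_or_ne v 0 with rfl | hv
    · simp
    have hv' : 0 < ‖v‖ := norm_pos_iff.2 hv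
    rw [norm_smul, norm_div, norm_pow, norm_norm, div_mul_eq_mul_div, div_le_iff₀ (by positivity)]
    have := norm_inner_le_norm (𝕜 := ℝ) v x
    nlinarith
  have := norm_sub_le x ((⟪v, x⟫ / ‖v‖ ^ 2) • v)
  unfold projPerp
  linarith

theorem norm_inv_norm_smul {x : F} (hx : x ≠ 0) : ‖‖x‖⁻¹ • x‖ = 1 := by
  rw [norm_smul, norm_inv, norm_norm, inv_mul_cancel₀ (norm_ne_zero_iff.2 hx)]

theorem HasDerivAt.inv_norm_smul {v : ℝ → F} {v' : F} {u : ℝ} (h : HasDerivAt v v' u)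
    (hv : v u ≠ 0) :
    HasDerivAt (fun u => ‖v u‖⁻¹ • v u) (‖v u‖⁻¹ • projPerp (‖v u‖⁻¹ • v u) v') u := by
  have hv' : ‖v u‖ ≠ 0 := norm_ne_zero_iff.2 hv
  have h1 : HasDerivAt (fun u => ‖v u‖) (⟪v u, v'⟫ / ‖v u‖) u := by
    have h2 := h.norm_sq.sqrt (by positivity)
    simp only [sqrt_sq (norm_nonneg _)] at h2
    convert! h2 using 1
    field_simp
  convert! (h1.inv hv').smul h using 1
  rw [projPerp, norm_inv_norm_smul hv, inner_smul_left, smul_sub, smul_smul, smul_smul,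
    sub_eq_add_neg, ← neg_smul]
  congr 2
  simp
  field_simp

theorem norm_inv_norm_smul_sub_le {x y : F} {δ : ℝ} (hδ : 0 < δ) (hx : δ ≤ ‖x‖) (hy : δ ≤ ‖y‖) :
    ‖‖x‖⁻¹ • x - ‖y‖⁻¹ • y‖ ≤ 2 / δ * ‖x - y‖ := by
  have hx0 : 0 < ‖x‖ := hδ.trans_le hx
  have hy0 : 0 < ‖y‖ := hδ.trans_le hy
  have h : ‖x‖⁻¹ • x - ‖y‖⁻¹ • y = ‖x‖⁻¹ • (x - y) + (‖x‖⁻¹ - ‖y‖⁻¹) • y := by module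
  have h1 : ‖(‖x‖⁻¹ - ‖y‖⁻¹) • y‖ = ‖x‖⁻¹ * |‖y‖ - ‖x‖| := by
    rw [norm_smul, norm_eq_abs, inv_sub_inv hx0.ne' hy0.ne', abs_div, abs_mul, abs_norm, abs_norm]
    field_simp
  have h2 : |‖y‖ - ‖x‖| ≤ ‖x - y‖ := by
    rw [norm_sub_rev]; exact abs_norm_sub_norm_le y x
  calc _ ≤ ‖‖x‖⁻¹ • (x - y)‖ + ‖(‖x‖⁻¹ - ‖y‖⁻¹) • y‖ := by rw [h]; exact norm_add_le _ _
    _ = ‖x‖⁻¹ * ‖x - y‖ + ‖x‖⁻¹ * |‖y‖ - ‖x‖| := by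
      rw [h1, norm_smul, norm_inv, norm_norm]
    _ ≤ ‖x‖⁻¹ * ‖x - y‖ + ‖x‖⁻¹ * ‖x - y‖ := by gcongr
    _ = 2 * ‖x‖⁻¹ * ‖x - y‖ := by ring
    _ ≤ 2 * δ⁻¹ * ‖x - y‖ := by gcongr
    _ = _ := by rw [div_eq_mul_inv]

theorem norm_sub_le_integral_of_lipschitz {φ : ℝ → F} {φ' : ℝ → F} {g : ℝ → ℝ} {K : NNReal}
    (hφ : LipschitzWith K φ) (hd : ∀ᵐ u : ℝ, HasDerivAt φ (φ' u) u)
    (hg : ∀ a b, IntervalIntegrable g volume a b) (hle : ∀ u, ‖φ' u‖ ≤ g u) {s t : ℝ}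
    (hst : s ≤ t) : ‖φ t - φ s‖ ≤ ∫ u in s..t, g u := by
  rcases eq_or_ne (φ t - φ s) 0 with h0 | h0
  · rw [h0, norm_zero]
    exact integral_nonneg hst fun u _ => (norm_nonneg _).trans (hle u)
  set e := φ t - φ s with he
  have he' : 0 < ‖e‖ := norm_pos_iff.2 h0
  have hlip : LipschitzWith (‖e‖₊ * K) (fun u => ⟪e, φ u⟫) := by
    refine LipschitzWith.of_dist_le_mul fun x y => ?_
    rw [dist_eq_norm, ← inner_sub_right]
    refine (norm_inner_le_norm _ _).trans ?_
    rw [NNReal.coe_mul, coe_nnnorm, mul_assoc, ← dist_eq_norm]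
    gcongr
    rw [← dist_eq_norm]
    exact hφ.dist_le_mul x y
  have hac := (hlip.lipschitzOnWith (s := uIcc s t)).absolutelyContinuousOnInterval
  have h1 := hac.integral_deriv_eq_sub
  have h2 : ∫ u in s..t, deriv (fun u => ⟪e, φ u⟫) u ≤ ∫ u in s..t, ‖e‖ * g u := by
    apply integral_mono_ae hst hac.intervalIntegrable_deriv ((hg s t).const_mul _)
    filter_upwards [hd] with u hu
    have h3 : HasDerivAt (fun u => ⟪e, φ u⟫) ⟪e, φ' u⟫ u := by
      simpa using (hasDerivAt_const u e).inner ℝ hu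
    rw [h3.deriv]
    exact (real_inner_le_norm _ _).trans (by gcongr; exact hle u)
  rw [h1, ← inner_sub_right, ← he, real_inner_self_eq_norm_sq, sq,
    intervalIntegral.integral_const_mul] at h2
  exact le_of_mul_le_mul_left h2 he'

end NormalizedCurve

namespace ClosedCurve

variable {n : ℕ} {γ : ClosedCurve n}

theorem ae_shift {P : ℝ → Prop} (h : ∀ᵐ u : ℝ, P u) (w : ℝ) : ∀ᵐ u : ℝ, P (u + w) :=
  (measurePreserving_add_right volume w).quasiMeasurePreserving.ae h

theorem ae_hasDerivAt_chord (γ : ClosedCurve n) (w : ℝ) :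
    ∀ᵐ u : ℝ, HasDerivAt (fun u => γ.toFun (u + w) - γ.toFun u)
      (γ.deriv' (u + w) - γ.deriv' u) u := by
  filter_upwards [γ.ae_hasDerivAt, ae_shift γ.ae_hasDerivAt w] with u h1 h2
  exact (h2.comp_add_const u w).sub h1

theorem norm_gaussMap (hinj : γ.IsInj) {w : ℝ} (hw : w ∈ Ioo (0:ℝ) 1) (u : ℝ) :
    ‖gaussMap γ u w‖ = 1 := norm_inv_norm_smul (hinj.sub_ne_zero hw u)

theorem exists_lipschitzWith_gaussMap (hinj : γ.IsInj) (harc : γ.IsArclength) {w : ℝ}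
    (hw : w ∈ Ioo (0:ℝ) 1) : ∃ K, LipschitzWith K (fun u => gaussMap γ u w) := by
  obtain ⟨δ, hδ, h⟩ := exists_pos_le_chord hinj harc hw
  refine ⟨(2 / δ * 2).toNNReal, LipschitzWith.of_dist_le_mul fun x y => ?_⟩
  rw [dist_eq_norm, dist_eq_norm, coe_toNNReal _ (by positivity)]
  refine (norm_inv_norm_smul_sub_le hδ (h x) (h y)).trans ?_
  rw [mul_assoc (2 / δ)]
  gcongr
  have h1 := harc.norm_sub_le (y + w) (x + w)
  have h2 := harc.norm_sub_le y x
  rw [add_sub_add_right_eq_sub] at h1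
  calc _ = ‖(γ.toFun (x + w) - γ.toFun (y + w)) - (γ.toFun x - γ.toFun y)‖ := by
        congr 1; abel
    _ ≤ _ := norm_sub_le _ _
    _ ≤ _ := by rw [norm_eq_abs]; linarith

theorem gaussDerivU_nonneg (γ : ClosedCurve n) (u w : ℝ) : 0 ≤ gaussDerivU γ u w := by
  unfold gaussDerivU; positivity

theorem aestronglyMeasurable_gaussDerivU (harc : γ.IsArclength) (w : ℝ) :
    AEStronglyMeasurable (fun u => gaussDerivU γ u w) volume := by
  have hc := harc.continuous
  have h1 : AEStronglyMeasurable γ.deriv' volume :=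
    γ.locallyIntegrable_deriv'.aestronglyMeasurable
  have h2 : AEStronglyMeasurable (fun u => γ.deriv' (u + w)) volume :=
    h1.comp_measurePreserving (measurePreserving_add_right volume w)
  have h3 : AEStronglyMeasurable (fun u => ‖γ.toFun (u + w) - γ.toFun u‖) volume :=
    Continuous.aestronglyMeasurable (by fun_prop)
  have h4 : AEStronglyMeasurable (fun u => gaussMap γ u w) volume := by
    refine h3.aemeasurable.inv.aestronglyMeasurable.smul ?_
    exact Continuous.aestronglyMeasurable (by fun_prop)
  have h5 := h2.sub h1
  have h6 : AEStronglyMeasurable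
      (fun u => projPerp (gaussMap γ u w) (γ.deriv' (u + w) - γ.deriv' u)) volume := by
    refine h5.sub (AEStronglyMeasurable.smul (f := fun u => ⟪gaussMap γ u w,
      γ.deriv' (u + w) - γ.deriv' u⟫ / ‖gaussMap γ u w‖ ^ 2) ?_ h4)
    exact ((h4.inner h5).aemeasurable.div (h4.norm.aemeasurable.pow_const 2)).aestronglyMeasurable
  exact (h6.norm.aemeasurable.div h3.aemeasurable).aestronglyMeasurable

theorem intervalIntegrable_gaussDerivU (hinj : γ.IsInj) (harc : γ.IsArclength) {w : ℝ}
    (hw : w ∈ Ioo (0:ℝ) 1) (a b : ℝ) :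
    IntervalIntegrable (fun u => gaussDerivU γ u w) volume a b := by
  obtain ⟨δ, hδ, h⟩ := exists_pos_le_chord hinj harc hw
  refine (intervalIntegrable_const (c := 4 / δ)).mono_fun
    (aestronglyMeasurable_gaussDerivU harc w).restrict (ae_restrict_of_ae ?_)
  filter_upwards [harc, ae_shift harc w] with u h1 h2
  rw [norm_of_nonneg (gaussDerivU_nonneg γ u w), norm_of_nonneg (by positivity), gaussDerivU]
  have h3 := norm_projPerp_le (gaussMap γ u w) (γ.deriv' (u + w) - γ.deriv' u)
  have h4 := norm_sub_le (γ.deriv' (u + w)) (γ.deriv' u)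
  gcongr
  · linarith
  · exact h u

theorem norm_gaussMap_sub_le_integral (hinj : γ.IsInj) (harc : γ.IsArclength) {w : ℝ}
    (hw : w ∈ Ioo (0:ℝ) 1) {s t : ℝ} (hst : s ≤ t) :
    ‖gaussMap γ t w - gaussMap γ s w‖ ≤ ∫ u in s..t, gaussDerivU γ u w := by
  obtain ⟨K, hK⟩ := exists_lipschitzWith_gaussMap hinj harc hw
  refine norm_sub_le_integral_of_lipschitz hK (φ' := fun u =>
    ‖γ.toFun (u + w) - γ.toFun u‖⁻¹ • projPerp (gaussMap γ u w) (γ.deriv' (u + w) - γ.deriv' u))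
    ?_ (intervalIntegrable_gaussDerivU hinj harc hw) (fun u => ?_) hst
  · filter_upwards [γ.ae_hasDerivAt_chord w] with u hu
    exact hu.inv_norm_smul (hinj.sub_ne_zero hw u)
  · rw [norm_smul, norm_inv, norm_norm, gaussDerivU, div_eq_inv_mul]

theorem integral_chord (harc : γ.IsArclength) (w : ℝ) :
    ∫ u in (0:ℝ)..1, (γ.toFun (u + w) - γ.toFun u) = 0 := by
  have hc := harc.continuous
  rw [intervalIntegral.integral_sub (Continuous.intervalIntegrable (by fun_prop) 0 1)
    (hc.intervalIntegrable 0 1), integral_comp_add_right (fun u => γ.toFun u) w, sub_eq_zero]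
  have := γ.periodic.intervalIntegral_add_eq (0 + w) 0
  rw [zero_add] at this ⊢
  rw [zero_add] at this
  rw [add_comm 1 w]
  exact this

theorem two_pi_le_integral_gaussDerivU (hinj : γ.IsInj) (harc : γ.IsArclength) {w : ℝ}
    (hw : w ∈ Ioo (0:ℝ) 1) : 2 * π ≤ ∫ u in (0:ℝ)..1, gaussDerivU γ u w := by
  have hc := harc.continuous
  obtain ⟨K, hK⟩ := exists_lipschitzWith_gaussMap hinj harc hw
  refine two_pi_le_integral_of_balanced (φ := fun u => gaussMap γ u w)
    (m := fun u => ‖γ.toFun (u + w) - γ.toFun u‖) (norm_gaussMap hinj hw) ?_ hK.continuous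
    (intervalIntegrable_gaussDerivU hinj harc hw)
    (fun s t => norm_gaussMap_sub_le_integral hinj harc hw)
    (fun u => norm_pos_iff.2 (hinj.sub_ne_zero hw u)) (by fun_prop) ?_
  · have := γ.periodic_chord w 0
    simp only [zero_add] at this
    simp only [gaussMap, zero_add, this]
  · rw [← integral_chord harc w]
    congr 1
    ext1 u
    rw [gaussMap, smul_smul, mul_inv_cancel₀ (norm_ne_zero_iff.2 (hinj.sub_ne_zero hw u)), one_smul]

end ClosedCurve

theorem ofReal_integral_le_lintegral {α : Type*} [MeasurableSpace α] {μ : Measure α} {f : α → ℝ}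
    (hf : Integrable f μ) : ENNReal.ofReal (∫ x, f x ∂μ) ≤ ∫⁻ x, ENNReal.ofReal (f x) ∂μ := by
  have h : ∫ x, f x ∂μ ≤ ∫ x, max (f x) 0 ∂μ :=
    MeasureTheory.integral_mono hf hf.pos_part fun x => le_max_left _ _
  refine (ENNReal.ofReal_le_ofReal h).trans (le_of_eq ?_)
  rw [ofReal_integral_eq_lintegral_ofReal hf.pos_part (ae_of_all _ fun x => le_max_right _ _)]
  simp

namespace ClosedCurve

variable {n : ℕ} {γ : ClosedCurve n}

/-- The lower bound for `Gw`, with a deficit term measuring the mean square chord length. -/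
theorem ofReal_le_Gw {p q : ℝ} (hq : 1 < q) (hp1 : 2 * q < p) (hp2 : p ≤ 4 * q - 2)
    (hinj : γ.IsInj) (harc : γ.IsArclength) {w : ℝ} (hw : w ∈ Ioo (0:ℝ) 1) :
    ENNReal.ofReal (π ^ (p - q) * sin (π * w) ^ (2 * q - p) *
      (1 + (p - 2 * q) / 2 * (1 - γ.chordSq w / (sin (π * w) ^ 2 / π ^ 2)))) ≤ Gw p q γ w := by
  have hc := harc.continuous
  have hsin : 0 < sin (π * w) := sin_pos_of_pos_of_lt_pi (mul_pos pi_pos hw.1)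
    (by nlinarith [pi_pos, hw.2])
  set Y := sin (π * w) ^ 2 / π ^ 2 with hY
  have hY0 : 0 < Y := by positivity
  set B := π ^ (p - q) * sin (π * w) ^ (2 * q - p) with hB
  have hB0 : 0 < B := by positivity
  let H : ℝ → ℝ := fun u => B * (1 + q * (gaussDerivU γ u w / (2 * π) - 1) -
    (p - 2 * q) / 2 * (‖γ.toFun (u + w) - γ.toFun u‖ ^ 2 / Y - 1))
  have hg := intervalIntegrable_gaussDerivU hinj harc hw 0 1
  have hd : IntervalIntegrable (fun u => ‖γ.toFun (u + w) - γ.toFun u‖ ^ 2) volume 0 1 :=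
    Continuous.intervalIntegrable (by fun_prop) 0 1
  have h1 := ((hg.div_const (2 * π)).sub (intervalIntegrable_const (c := (1:ℝ)))).const_mul q
  have h2 := ((hd.div_const Y).sub (intervalIntegrable_const (c := (1:ℝ)))).const_mul
    ((p - 2 * q) / 2)
  have h3 := (intervalIntegrable_const (c := (1:ℝ)) (μ := volume) (a := 0) (b := 1)).add h1
  have hHi : IntervalIntegrable H volume 0 1 := (h3.sub h2).const_mul B
  have hHval : ∫ u in (0:ℝ)..1, H u =
      B * (1 + q * ((∫ u in (0:ℝ)..1, gaussDerivU γ u w) / (2 * π) - 1)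
      - (p - 2 * q) / 2 * (γ.chordSq w / Y - 1)) := by
    simp only [H]
    rw [intervalIntegral.integral_const_mul, intervalIntegral.integral_sub h3 h2,
      intervalIntegral.integral_add intervalIntegrable_const h1,
      intervalIntegral.integral_const_mul, intervalIntegral.integral_const_mul,
      intervalIntegral.integral_sub (hg.div_const _) intervalIntegrable_const,
      intervalIntegral.integral_sub (hd.div_const _) intervalIntegrable_const,
      intervalIntegral.integral_div, intervalIntegral.integral_div]
    simp [chordSq]
  have hH : ∀ u, H u ≤ (1/2 * gaussDerivU γ u w) ^ q *
      ‖γ.toFun (u + w) - γ.toFun u‖ ^ (2*q - p) := by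
    intro u
    have hd0 : 0 < ‖γ.toFun (u + w) - γ.toFun u‖ := norm_pos_iff.2 (hinj.sub_ne_zero hw u)
    set d := ‖γ.toFun (u + w) - γ.toFun u‖
    have hg0 := gaussDerivU_nonneg γ u w
    set g := gaussDerivU γ u w
    have h4 := convex_tangent_bound (q := q) (β := (p - 2 * q) / 2) (s := g / (2 * π))
      (t := d ^ 2 / Y) hq (by linarith) (by linarith) (by positivity) (by positivity)
    refine (mul_le_mul_of_nonneg_left h4 hB0.le).trans (le_of_eq ?_)
    have h5 : d ^ 2 / Y = (d / (sin (π * w) / π)) ^ 2 := by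
      rw [hY]; field_simp
    have h6 : (1 / 2 * g) = g / (2 * π) * π := by field_simp
    have h7 : -((p - 2 * q) / 2) = (2 * q - p) / 2 := by ring
    rw [h5, h6, h7, ← rpow_natCast (d / (sin (π * w) / π)) 2, ← rpow_mul (by positivity),
      mul_rpow (by positivity) pi_pos.le]
    have h8 : ((2:ℕ):ℝ) * ((2 * q - p) / 2) = 2 * q - p := by push_cast; ring
    rw [h8, div_rpow hd0.le (by positivity), div_rpow hsin.le pi_pos.le, hB]
    have h9 : π ^ (p - q) * π ^ (2 * q - p) = π ^ q := by
      rw [← rpow_add pi_pos]; ring_nf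
    have h10 : sin (π * w) ^ (2 * q - p) ≠ 0 := (rpow_pos_of_pos hsin _).ne'
    field_simp
    rw [← h9]
    ring_nf
  have hfinal : B * (1 + (p - 2 * q) / 2 * (1 - γ.chordSq w / Y)) ≤ ∫ u in (0:ℝ)..1, H u := by
    rw [hHval]
    apply mul_le_mul_of_nonneg_left _ hB0.le
    have h11 : 1 ≤ (∫ u in (0:ℝ)..1, gaussDerivU γ u w) / (2 * π) := by
      rw [one_le_div (by positivity)]
      exact two_pi_le_integral_gaussDerivU hinj harc hw
    nlinarith
  refine (ENNReal.ofReal_le_ofReal hfinal).trans ?_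
  rw [integral_of_le zero_le_one]
  refine (ofReal_integral_le_lintegral
    ((intervalIntegrable_iff_integrableOn_Ioc_of_le zero_le_one).1 hHi)).trans ?_
  exact lintegral_mono fun u => ENNReal.ofReal_le_ofReal (hH u)

end ClosedCurve

namespace ClosedCurve

variable {n : ℕ} {γ : ClosedCurve n}

/-- The curve is a round circle of length one traversed once with unit speed. -/
def IsUnitSpeedCircle (γ : ClosedCurve n) : Prop :=
  ∃ c a b : EuclideanSpace ℝ (Fin n), ‖a‖ = (2 * π)⁻¹ ∧ ‖b‖ = (2 * π)⁻¹ ∧ ⟪a, b⟫ = 0 ∧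
    ∀ u, γ.toFun u = c + cos (2 * π * u) • a + sin (2 * π * u) • b

end ClosedCurve

theorem hasDerivAt_trig {F : Type*} [NormedAddCommGroup F] [NormedSpace ℝ F] (c a b : F) (u : ℝ) :
    HasDerivAt (fun u : ℝ => c + cos (2 * π * u) • a + sin (2 * π * u) • b)
      ((2 * π) • (cos (2 * π * u) • b - sin (2 * π * u) • a)) u := by
  have h0 : HasDerivAt (fun u : ℝ => 2 * π * u) (2 * π) u := by
    simpa using (hasDerivAt_id u).const_mul (2 * π)
  have h1 := ((h0.cos.smul_const a).const_add c).add (h0.sin.smul_const b)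
  refine h1.congr_deriv ?_
  module

theorem norm_sq_cos_smul_add_sin_smul {F : Type*} [NormedAddCommGroup F] [InnerProductSpace ℝ F]
    {a b : F} (hab : ⟪a, b⟫ = 0) (h : ‖a‖ = ‖b‖) {x y : ℝ} :
    ‖x • a + y • b‖ ^ 2 = (x ^ 2 + y ^ 2) * ‖a‖ ^ 2 := by
  rw [norm_add_sq_real, norm_smul, norm_smul, real_inner_smul_left, real_inner_smul_right, hab, ← h,
    mul_pow, mul_pow, norm_eq_abs, norm_eq_abs, sq_abs, sq_abs]
  ring

namespace ClosedCurve

variable {n : ℕ} {γ : ClosedCurve n}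

theorem ae_deriv'_eq_trig {c a b : EuclideanSpace ℝ (Fin n)}
    (h : ∀ u, γ.toFun u = c + cos (2 * π * u) • a + sin (2 * π * u) • b) :
    ∀ᵐ u, γ.deriv' u = (2 * π) • (cos (2 * π * u) • b - sin (2 * π * u) • a) := by
  filter_upwards [γ.ae_hasDerivAt] with u hu
  rw [funext h] at hu
  exact hu.unique (hasDerivAt_trig c a b u)

theorem IsArclength.isUnitSpeedCircle (harc : γ.IsArclength) {c a b : EuclideanSpace ℝ (Fin n)}
    (h : ∀ u, γ.toFun u = c + cos (2 * π * u) • a + sin (2 * π * u) • b) :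
    γ.IsUnitSpeedCircle := by
  have h1 : (fun u : ℝ => ‖(2 * π) • (cos (2 * π * u) • b - sin (2 * π * u) • a)‖)
      = fun _ => 1 := by
    refine (Continuous.ae_eq_iff_eq volume (by fun_prop) (by fun_prop)).1 ?_
    filter_upwards [harc, ae_deriv'_eq_trig h] with u h2 h3
    rw [← h3, h2]
  have h2 : ∀ u : ℝ, ‖cos (2 * π * u) • b - sin (2 * π * u) • a‖ = (2 * π)⁻¹ := by
    intro u
    have := congrFun h1 u
    simp only [norm_smul (2 * π), norm_of_nonneg two_pi_pos.le] at this
    rw [eq_inv_of_mul_eq_one_right this]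
  have hb : ‖b‖ = (2 * π)⁻¹ := by simpa using h2 0
  have ha : ‖a‖ = (2 * π)⁻¹ := by
    have := h2 (1/4)
    rwa [show 2 * π * (1/4) = π / 2 by ring, cos_pi_div_two, sin_pi_div_two, zero_smul, one_smul,
      zero_sub, norm_neg] at this
  refine ⟨c, a, b, ha, hb, ?_, h⟩
  have h3 := h2 (1/8)
  rw [show 2 * π * (1/8) = π / 4 by ring, cos_pi_div_four, sin_pi_div_four, ← smul_sub, norm_smul,
    norm_of_nonneg (by positivity)] at h3
  have h4 : (√2 / 2) ^ 2 * ‖b - a‖ ^ 2 = (2 * π)⁻¹ ^ 2 := by rw [← h3]; ring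
  rw [norm_sub_sq_real, ha, hb, div_pow, sq_sqrt zero_le_two, real_inner_comm] at h4
  linarith

theorem IsUnitSpeedCircle.isCircle (h : γ.IsUnitSpeedCircle) : IsCircle (range γ.toFun) := by
  obtain ⟨c, a, b, ha, hb, hab, h⟩ := h
  have hp : (0:ℝ) < (2 * π)⁻¹ := by positivity
  have ha0 : a ≠ 0 := norm_pos_iff.1 (ha ▸ hp)
  have hb0 : b ≠ 0 := norm_pos_iff.1 (hb ▸ hp)
  refine ⟨c, (2 * π)⁻¹, Submodule.span ℝ (range ![a, b]), hp, ?_, ?_⟩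
  · rw [finrank_span_eq_card]
    · simp
    · refine linearIndependent_of_ne_zero_of_inner_eq_zero (𝕜 := ℝ) ?_ ?_
      · intro i; fin_cases i <;> simpa
      · intro i j hij
        fin_cases i <;> fin_cases j <;> simp_all [real_inner_comm]
  · ext x
    simp only [mem_range, mem_ofPred_eq, Matrix.range_cons, Matrix.range_empty, union_empty,
      singleton_union, Submodule.mem_span_pair]
    constructor
    · rintro ⟨u, rfl⟩
      have h1 : γ.toFun u - c = cos (2 * π * u) • a + sin (2 * π * u) • b := by rw [h]; abel
      rw [h1]
      refine ⟨?_, _, _, rfl⟩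
      rw [← sq_eq_sq₀ (norm_nonneg _) hp.le, norm_sq_cos_smul_add_sin_smul hab (ha.trans hb.symm),
        cos_sq_add_sin_sq, ha, one_mul]
    · rintro ⟨hx, s, t, hst⟩
      rw [← hst, ← sq_eq_sq₀ (norm_nonneg _) hp.le,
        norm_sq_cos_smul_add_sin_smul hab (ha.trans hb.symm), ha] at hx
      have h1 : s ^ 2 + t ^ 2 = 1 :=
        mul_right_cancel₀ (pow_pos hp 2).ne' (hx.trans (one_mul _).symm)
      have hz : ‖(⟨s, t⟩ : ℂ)‖ = 1 := by
        rw [Complex.norm_def, Complex.normSq_mk, ← sq, ← sq, h1, sqrt_one]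
      have hc := Complex.norm_mul_cos_arg ⟨s, t⟩
      have hs := Complex.norm_mul_sin_arg ⟨s, t⟩
      rw [hz, one_mul] at hc hs
      refine ⟨Complex.arg ⟨s, t⟩ / (2 * π), ?_⟩
      rw [h, mul_div_cancel₀ _ two_pi_pos.ne', hc, hs, add_assoc]
      simp only
      rw [hst, add_sub_cancel]

theorem IsUnitSpeedCircle.norm_chord (h : γ.IsUnitSpeedCircle) {w : ℝ} (hw : w ∈ Ioo (0:ℝ) 1) :
    ∀ᵐ u, ‖γ.toFun (u + w) - γ.toFun u‖ = sin (π * w) / π ∧ gaussDerivU γ u w = 2 * π := by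
  obtain ⟨c, a, b, ha, hb, hab, h⟩ := h
  have hsin : 0 < sin (π * w) := sin_pos_of_pos_of_lt_pi (mul_pos pi_pos hw.1)
    (by nlinarith [pi_pos, hw.2])
  have hd := ae_deriv'_eq_trig h
  have hd' : ∀ᵐ u, γ.deriv' (u + w) =
      (2 * π) • (cos (2 * π * (u + w)) • b - sin (2 * π * (u + w)) • a) :=
    (measurePreserving_add_right volume w).quasiMeasurePreserving.ae hd
  filter_upwards [hd, hd'] with u h1 h2
  set v := π * w + 2 * π * u with hv
  have e1 : 2 * π * (u + w) = v + π * w := by rw [hv]; ring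
  have e2 : 2 * π * u = v - π * w := by rw [hv]; ring
  have h3 : γ.toFun (u + w) - γ.toFun u
      = (2 * sin (π * w)) • ((-sin v) • a + cos v • b) := by
    rw [h, h, e1, e2, cos_add v, cos_sub, sin_add v, sin_sub]
    module
  have h4 : γ.deriv' (u + w) - γ.deriv' u
      = (-(2 * π) * (2 * sin (π * w))) • (cos v • a + sin v • b) := by
    rw [h1, h2, e1, e2, cos_add v, cos_sub, sin_add v, sin_sub]
    module
  have hab' : ‖a‖ = ‖b‖ := ha.trans hb.symm
  have n1 : ‖(-sin v) • a + cos v • b‖ = (2 * π)⁻¹ := by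
    rw [← sq_eq_sq₀ (norm_nonneg _) (by positivity), norm_sq_cos_smul_add_sin_smul hab hab', ha,
      neg_sq, sin_sq_add_cos_sq, one_mul]
  have n2 : ‖cos v • a + sin v • b‖ = (2 * π)⁻¹ := by
    rw [← sq_eq_sq₀ (norm_nonneg _) (by positivity), norm_sq_cos_smul_add_sin_smul hab hab', ha,
      cos_sq_add_sin_sq, one_mul]
  have hn : ‖γ.toFun (u + w) - γ.toFun u‖ = sin (π * w) / π := by
    rw [h3, norm_smul, n1, norm_of_nonneg (by positivity)]
    field_simp
  refine ⟨hn, ?_⟩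
  have hin : ⟪gaussMap γ u w, γ.deriv' (u + w) - γ.deriv' u⟫ = 0 := by
    rw [gaussMap, h3, h4]
    simp only [real_inner_smul_right, inner_add_right, hab,
      real_inner_comm, real_inner_self_eq_norm_sq, ha, hb]
    ring
  rw [gaussDerivU, projPerp, hin, zero_div, zero_smul, sub_zero, hn, h4, norm_smul, n2, norm_mul,
    norm_neg, norm_of_nonneg two_pi_pos.le, norm_of_nonneg (by positivity)]
  field_simp

theorem IsUnitSpeedCircle.Gw_eq (h : γ.IsUnitSpeedCircle) {w : ℝ} (hw : w ∈ Ioo (0:ℝ) 1)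
    (p q : ℝ) : Gw p q γ w = ENNReal.ofReal (π ^ (p - q) * sin (π * w) ^ (2 * q - p)) := by
  have hsin : 0 < sin (π * w) := sin_pos_of_pos_of_lt_pi (mul_pos pi_pos hw.1)
    (by nlinarith [pi_pos, hw.2])
  have h1 : Gw p q γ w = ∫⁻ _ in Ioc (0:ℝ) 1,
      ENNReal.ofReal (π ^ (p - q) * sin (π * w) ^ (2 * q - p)) := by
    refine lintegral_congr_ae (ae_restrict_of_ae ?_)
    filter_upwards [h.norm_chord hw] with u hu
    rw [hu.1, hu.2, div_rpow hsin.le pi_pos.le, show 1 / 2 * (2 * π) = π by ring]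
    congr 1
    rw [show p - q = q - (2 * q - p) by ring, rpow_sub pi_pos q]
    ring
  rw [h1]
  simp

end ClosedCurve

/-- A planar Lipschitz curve of unit speed on a circle of radius `r` has an angle function of
speed `r⁻¹`. -/
theorem exists_angle {x y : ℝ → ℝ} {r : ℝ} (hr : 0 < r) (hx : LipschitzWith 1 x)
    (hy : LipschitzWith 1 y) (hxy : ∀ u, x u ^ 2 + y u ^ 2 = r ^ 2)
    (hd : ∀ᵐ u, DifferentiableAt ℝ x u ∧ DifferentiableAt ℝ y u ∧
      deriv x u ^ 2 + deriv y u ^ 2 = 1) :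
    ∃ θ κ : ℝ → ℝ, LipschitzWith (Real.toNNReal r⁻¹) θ ∧ θ 0 = 0 ∧
      (∀ᵐ u, HasDerivAt θ (κ u) u ∧ (κ u = r⁻¹ ∨ κ u = -r⁻¹)) ∧
      ∀ u ∈ Icc (0:ℝ) 1, x u = x 0 * cos (θ u) - y 0 * sin (θ u) ∧
        y u = x 0 * sin (θ u) + y 0 * cos (θ u) := by
  let κ : ℝ → ℝ := fun u => (x u * deriv y u - y u * deriv x u) / r ^ 2
  have hκm : Measurable κ := by
    have := hx.continuous.measurable
    have := hy.continuous.measurable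
    have := measurable_deriv x
    have := measurable_deriv y
    fun_prop
  have horth : ∀ᵐ u, x u * deriv x u + y u * deriv y u = 0 := by
    filter_upwards [hd] with u ⟨h1, h2, _⟩
    have h3 := (h1.hasDerivAt.pow 2).add (h2.hasDerivAt.pow 2)
    have h4 : x ^ 2 + y ^ 2 = fun _ => r ^ 2 := funext hxy
    rw [h4] at h3
    have := h3.unique (hasDerivAt_const u _)
    norm_num at this
    linarith
  have hκ : ∀ᵐ u, κ u = r⁻¹ ∨ κ u = -r⁻¹ := by
    filter_upwards [hd, horth] with u ⟨_, _, h3⟩ h4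
    rw [← sq_eq_sq_iff_eq_or_eq_neg, div_pow, inv_pow, div_eq_iff (by positivity)]
    have : (x u * deriv y u - y u * deriv x u) ^ 2 = r ^ 2 := by
      linear_combination (x u ^ 2 + y u ^ 2) * h3 + hxy u
        - (x u * deriv x u + y u * deriv y u) * h4
    rw [this]
    field_simp
  have hκle : ∀ᵐ u, ‖κ u‖ ≤ r⁻¹ := by
    filter_upwards [hκ] with u hu
    rcases hu with hu | hu <;> rw [hu] <;> simp [abs_of_pos hr]
  have hκi : ∀ a b, IntervalIntegrable κ volume a b := fun a b =>
    (intervalIntegrable_const (c := r⁻¹)).mono_fun hκm.aestronglyMeasurable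
      (ae_restrict_of_ae (by
        filter_upwards [hκle] with u hu
        rwa [norm_of_nonneg (inv_pos.2 hr).le]))
  have hκl : LocallyIntegrable κ volume := by
    intro x
    refine ⟨Icc (x - 1) (x + 1), Icc_mem_nhds (by linarith) (by linarith), ?_⟩
    rw [← intervalIntegrable_iff_integrableOn_Icc_of_le (by linarith)]
    exact hκi _ _
  let θ : ℝ → ℝ := fun t => ∫ s in (0:ℝ)..t, κ s
  have hθd : ∀ᵐ u, HasDerivAt θ (κ u) u := by
    filter_upwards [LocallyIntegrable.ae_hasDerivAt_integral hκl] with u hu using hu 0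
  have hθl : LipschitzWith (Real.toNNReal r⁻¹) θ := LipschitzWith.of_dist_le_mul fun s t => by
    rw [dist_eq_norm, dist_eq_norm, Real.coe_toNNReal _ (inv_pos.2 hr).le, norm_eq_abs (s - t)]
    simp only [θ]
    rw [integral_interval_sub_left (hκi _ _) (hκi _ _)]
    exact norm_integral_le_of_norm_le_const_ae
      (by filter_upwards [hκle] with u hu _ using hu)
  have hac : ∀ {f : ℝ → ℝ} {K}, LipschitzWith K f → AbsolutelyContinuousOnInterval f 0 1 :=
    fun h => (h.lipschitzOnWith).absolutelyContinuousOnInterval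
  have hcl : LipschitzWith _ fun u => cos (θ u) := Real.lipschitzWith_cos.comp hθl
  have hsl : LipschitzWith _ fun u => sin (θ u) := Real.lipschitzWith_sin.comp hθl
  have hder : ∀ᵐ u, HasDerivAt (fun u => x u * cos (θ u) + y u * sin (θ u)) 0 u ∧
      HasDerivAt (fun u => y u * cos (θ u) - x u * sin (θ u)) 0 u := by
    filter_upwards [hd, horth, hθd] with u ⟨h1, h2, _⟩ h4 h5
    have e1 : deriv x u + y u * κ u = 0 := by
      simp only [κ]
      field_simp
      linear_combination (-deriv x u) * hxy u + x u * h4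
    have e2 : deriv y u - x u * κ u = 0 := by
      simp only [κ]
      field_simp
      linear_combination (-deriv y u) * hxy u + y u * h4
    constructor
    · refine ((h1.hasDerivAt.mul h5.cos).add (h2.hasDerivAt.mul h5.sin)).congr_deriv ?_
      linear_combination cos (θ u) * e1 + sin (θ u) * e2
    · refine ((h2.hasDerivAt.mul h5.cos).sub (h1.hasDerivAt.mul h5.sin)).congr_deriv ?_
      linear_combination cos (θ u) * e2 - sin (θ u) * e1
  have hθ0 : θ 0 = 0 := by simp [θ]
  obtain ⟨P, hP⟩ := AbsolutelyContinuousOnInterval.const_of_ae_hasDerivAt_zero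
    (((hac hx).fun_mul (hac hcl)).add ((hac hy).fun_mul (hac hsl)))
    (by filter_upwards [hder] with u hu _ using hu.1)
  obtain ⟨Q, hQ⟩ := AbsolutelyContinuousOnInterval.const_of_ae_hasDerivAt_zero
    (((hac hy).fun_mul (hac hcl)).sub ((hac hx).fun_mul (hac hsl)))
    (by filter_upwards [hder] with u hu _ using hu.2)
  simp only [uIcc_of_le (zero_le_one' ℝ), Pi.add_apply, Pi.sub_apply] at hP hQ
  have hP0 : x 0 = P := by simpa [hθ0] using hP 0 (by simp)
  have hQ0 : y 0 = Q := by simpa [hθ0] using hQ 0 (by simp)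
  refine ⟨θ, κ, hθl, hθ0, hθd.and hκ, fun u hu => ?_⟩
  rw [hP0, hQ0, ← hP u hu, ← hQ u hu]
  have h1 := cos_sq_add_sin_sq (θ u)
  constructor
  · linear_combination (-x u) * h1
  · linear_combination (-y u) * h1

/-- An injective Lipschitz function on `[0, 1]` whose derivative is a.e. `±k` is linear. -/
theorem eq_mul_or_eq_neg_mul_of_injOn {θ κ : ℝ → ℝ} {K : NNReal} {k : ℝ} (hk : 0 ≤ k)
    (hθ : LipschitzWith K θ)
    (h0 : θ 0 = 0) (hd : ∀ᵐ u, HasDerivAt θ (κ u) u ∧ (κ u = k ∨ κ u = -k))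
    (hinj : InjOn θ (Ioo 0 1)) :
    ∃ σ : ℝ, (σ = 1 ∨ σ = -1) ∧ ∀ u ∈ Icc (0:ℝ) 1, θ u = σ * (k * u) := by
  have hne : ∀ᵐ u : ℝ, u ≠ 0 ∧ u ≠ 1 := by
    filter_upwards [volume.ae_ne 0, volume.ae_ne 1] with u h1 h2 using ⟨h1, h2⟩
  have key : ∀ σ : ℝ, (∀ᵐ u, u ∈ Ioo (0:ℝ) 1 → HasDerivAt θ (σ * k) u) →
      ∀ u ∈ Icc (0:ℝ) 1, θ u = σ * (k * u) := by
    intro σ hσ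
    have hl : LipschitzWith (Real.toNNReal |σ * k|) fun u => σ * k * u :=
      LipschitzWith.of_dist_le_mul fun s t => by
        rw [dist_eq_norm, dist_eq_norm, Real.coe_toNNReal _ (abs_nonneg _), ← mul_sub, norm_mul]
        rfl
    obtain ⟨C, hC⟩ := AbsolutelyContinuousOnInterval.const_of_ae_hasDerivAt_zero
      (a := 0) (b := 1) (f := fun u => θ u - σ * k * u)
      ((hθ.lipschitzOnWith).absolutelyContinuousOnInterval.sub
        (hl.lipschitzOnWith).absolutelyContinuousOnInterval)
      (by
        filter_upwards [hσ, hne] with u h1 h2 h3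
        rw [uIcc_of_le zero_le_one] at h3
        have h4 : u ∈ Ioo (0:ℝ) 1 := ⟨h3.1.lt_of_ne' h2.1, h3.2.lt_of_ne h2.2⟩
        refine ((h1 h4).sub ((hasDerivAt_id u).const_mul (σ * k))).congr_deriv (by simp))
    rw [uIcc_of_le zero_le_one] at hC
    intro u hu
    have h1 := hC 0 (by simp)
    have h2 := hC u hu
    simp only [h0] at h1 h2
    linarith
  rcases ContinuousOn.strictMonoOn_of_injOn_Ioo zero_lt_one hθ.continuous.continuousOn hinj
    with h | h
  · refine ⟨1, Or.inl rfl, key 1 ?_⟩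
    filter_upwards [hd] with u ⟨h1, h2⟩ hu
    have h3 : 0 ≤ κ u := by
      rw [← h1.deriv, ← derivWithin_of_isOpen isOpen_Ioo hu]
      exact h.monotoneOn.derivWithin_nonneg
    rwa [show 1 * k = κ u by rcases h2 with h2 | h2 <;> linarith]
  · refine ⟨-1, Or.inr rfl, key (-1) ?_⟩
    filter_upwards [hd] with u ⟨h1, h2⟩ hu
    have h3 : κ u ≤ 0 := by
      rw [← h1.deriv, ← derivWithin_of_isOpen isOpen_Ioo hu]
      exact h.antitoneOn.derivWithin_nonpos
    rwa [show -1 * k = κ u by rcases h2 with h2 | h2 <;> linarith]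

namespace ClosedCurve

variable {n : ℕ} {γ : ClosedCurve n}

theorem IsInj.isUnitSpeedCircle (hinj : γ.IsInj) (harc : γ.IsArclength)
    (h : IsCircle (range γ.toFun)) : γ.IsUnitSpeedCircle := by
  obtain ⟨c, r, V, hr, hV, hS⟩ := h
  have hmem : ∀ u, ‖γ.toFun u - c‖ = r ∧ γ.toFun u - c ∈ V := fun u => by
    have : γ.toFun u ∈ range γ.toFun := mem_range_self u
    rwa [hS] at this
  let e := (stdOrthonormalBasis ℝ V).reindex (finCongr hV)
  let e₁ : EuclideanSpace ℝ (Fin n) := e 0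
  let e₂ : EuclideanSpace ℝ (Fin n) := e 1
  have n₁ : ‖e₁‖ = 1 := e.norm_eq_one 0
  have n₂ : ‖e₂‖ = 1 := e.norm_eq_one 1
  have n₁₂ : ⟪e₁, e₂⟫ = 0 := e.inner_eq_zero (by decide : (0 : Fin 2) ≠ 1)
  let x : ℝ → ℝ := fun u => ⟪e₁, γ.toFun u - c⟫
  let y : ℝ → ℝ := fun u => ⟪e₂, γ.toFun u - c⟫
  have hγ : ∀ u, γ.toFun u - c = x u • e₁ + y u • e₂ := by
    intro u
    have h1 := e.sum_repr' ⟨_, (hmem u).2⟩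
    rw [Fin.sum_univ_two] at h1
    exact (congrArg Subtype.val h1).symm
  have hnorm : ∀ s t : ℝ, ‖s • e₁ + t • e₂‖ ^ 2 = s ^ 2 + t ^ 2 := fun s t => by
    rw [norm_sq_cos_smul_add_sin_smul n₁₂ (n₁.trans n₂.symm), n₁, one_pow, mul_one]
  have hxy : ∀ u, x u ^ 2 + y u ^ 2 = r ^ 2 := fun u => by
    rw [← hnorm, ← hγ, (hmem u).1]
  have hlip : ∀ v : EuclideanSpace ℝ (Fin n), ‖v‖ = 1 →
      LipschitzWith 1 fun u => ⟪v, γ.toFun u - c⟫ := fun v hv =>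
    LipschitzWith.of_dist_le_mul fun s t => by
      rw [dist_eq_norm, ← inner_sub_right, sub_sub_sub_cancel_right]
      refine (norm_inner_le_norm _ _).trans ?_
      rw [hv, one_mul, NNReal.coe_one, one_mul]
      exact harc.norm_sub_le t s
  have hd : ∀ᵐ u, DifferentiableAt ℝ x u ∧ DifferentiableAt ℝ y u ∧
      deriv x u ^ 2 + deriv y u ^ 2 = 1 := by
    filter_upwards [γ.ae_hasDerivAt, harc] with u h1 h2
    have hx : DifferentiableAt ℝ x u :=
      (differentiableAt_const e₁).inner ℝ (h1.differentiableAt.sub_const c)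
    have hy : DifferentiableAt ℝ y u :=
      (differentiableAt_const e₂).inner ℝ (h1.differentiableAt.sub_const c)
    refine ⟨hx, hy, ?_⟩
    have h3 : γ.toFun = fun u => c + (x u • e₁ + y u • e₂) := funext fun u => by
      rw [← hγ, add_sub_cancel]
    rw [h3] at h1
    rw [← hnorm, ← h1.unique (((hx.hasDerivAt.smul_const e₁).add
      (hy.hasDerivAt.smul_const e₂)).const_add c), h2, one_pow]
  obtain ⟨θ, κ, hθl, hθ0, hθd, hθ⟩ := exists_angle hr (hlip e₁ n₁) (hlip e₂ n₂) hxy hd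
  have hrep : ∀ u ∈ Icc (0:ℝ) 1, γ.toFun u = c + cos (θ u) • (x 0 • e₁ + y 0 • e₂) +
      sin (θ u) • (-y 0 • e₁ + x 0 • e₂) := fun u hu => by
    have h1 : γ.toFun u = c + (x u • e₁ + y u • e₂) := by rw [← hγ, add_sub_cancel]
    obtain ⟨h2, h3⟩ := hθ u hu
    change x u = x 0 * cos (θ u) - y 0 * sin (θ u) at h2
    change y u = x 0 * sin (θ u) + y 0 * cos (θ u) at h3
    rw [h1, h2, h3]
    module
  have hinjθ : InjOn θ (Ioo 0 1) := by
    intro s hs t ht hst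
    obtain ⟨m, hm⟩ := hinj s t (by
      rw [hrep s (Ioo_subset_Icc_self hs), hrep t (Ioo_subset_Icc_self ht), hst])
    have h1 : (m:ℝ) < 1 := by linarith [hs.2, ht.1]
    have h2 : (-1:ℝ) < m := by linarith [hs.1, ht.2]
    have h3 : m < 1 := by exact_mod_cast h1
    have h4 : -1 < m := by exact_mod_cast h2
    have h5 : m = 0 := by omega
    rw [h5, Int.cast_zero] at hm
    linarith
  obtain ⟨σ, hσ, hlin⟩ := eq_mul_or_eq_neg_mul_of_injOn (inv_pos.2 hr).le hθl hθ0 hθd hinjθ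
  have hrep' : ∀ u ∈ Icc (0:ℝ) 1, γ.toFun u = c + cos (r⁻¹ * u) • (x 0 • e₁ + y 0 • e₂) +
      sin (r⁻¹ * u) • (σ • (-y 0 • e₁ + x 0 • e₂)) := fun u hu => by
    rw [hrep u hu, hlin u hu]
    rcases hσ with rfl | rfl <;> simp
  set a := x 0 • e₁ + y 0 • e₂ with ha
  set b := σ • (-y 0 • e₁ + x 0 • e₂) with hb
  have na : ‖a‖ = r := by
    rw [← sq_eq_sq₀ (norm_nonneg _) hr.le, ha, hnorm, hxy]
  have nb : ‖b‖ = r := by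
    have : ‖-y 0 • e₁ + x 0 • e₂‖ = r := by
      rw [← sq_eq_sq₀ (norm_nonneg _) hr.le, hnorm, ← hxy 0]
      ring
    rw [hb, norm_smul, this]
    rcases hσ with rfl | rfl <;> simp
  have nab : ⟪a, b⟫ = 0 := by
    rw [ha, hb]
    simp only [real_inner_smul_right, inner_add_left, inner_add_right, n₁₂,
      real_inner_comm, real_inner_self_eq_norm_sq, n₁, n₂]
    ring
  have hcos : cos r⁻¹ = 1 := by
    have h1 := hrep' 1 (by simp)
    have h2 := γ.periodic 0
    rw [zero_add, h1, hrep' 0 (by simp)] at h2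
    simp only [mul_one, mul_zero, cos_zero, sin_zero, one_smul, zero_smul, add_zero,
      add_assoc] at h2
    have h3 := congrArg (fun v => ⟪a, v⟫) (add_left_cancel h2)
    simp only [real_inner_smul_right, inner_add_right, nab, real_inner_self_eq_norm_sq, na] at h3
    have : r ^ 2 ≠ 0 := by positivity
    rw [mul_zero, add_zero] at h3
    exact mul_right_cancel₀ this (h3.trans (one_mul _).symm)
  obtain ⟨k, hk⟩ := (Real.cos_eq_one_iff _).1 hcos
  have hk0 : 0 < k := by
    have h1 : 0 < (k:ℝ) * (2 * π) := hk ▸ inv_pos.2 hr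
    exact_mod_cast pos_of_mul_pos_left h1 two_pi_pos.le
  have hkR : (0:ℝ) < k := by exact_mod_cast hk0
  have hk1 : k = 1 := by
    by_contra hne
    have hk2 : (2:ℝ) ≤ k := by exact_mod_cast (by omega : 2 ≤ k)
    have h1 : (k:ℝ)⁻¹ < 1 := inv_lt_one_of_one_lt₀ (by linarith)
    refine hinj.sub_ne_zero ⟨inv_pos.2 hkR, h1⟩ 0 ?_
    rw [zero_add, hrep' _ ⟨(inv_pos.2 hkR).le, h1.le⟩, hrep' 0 (by simp), ← hk,
      show (k:ℝ) * (2 * π) * (k:ℝ)⁻¹ = 2 * π by field_simp]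
    simp
  rw [hk1, Int.cast_one, one_mul] at hk
  have hr' : r = (2 * π)⁻¹ := by rw [hk, inv_inv]
  refine ⟨c, a, b, na.trans hr', nb.trans hr', nab, fun u => ?_⟩
  have h1 : γ.toFun u = γ.toFun (Int.fract u) := by
    rw [Int.fract]
    simpa using (Function.Periodic.sub_int_mul_eq γ.periodic ⌊u⌋ (x := u)).symm
  have h2 : 2 * π * u = 2 * π * Int.fract u + ⌊u⌋ * (2 * π) := by
    conv_lhs => rw [← Int.fract_add_floor u]
    ring
  rw [h1, hrep' _ ⟨Int.fract_nonneg u, (Int.fract_lt_one u).le⟩, ← hk, h2, cos_add_int_mul_two_pi,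
    sin_add_int_mul_two_pi]

end ClosedCurve

theorem integrableOn_sin_pi_mul_rpow {s : ℝ} (hs : -1 < s) (hs0 : s ≤ 0) :
    IntegrableOn (fun w => sin (π * w) ^ s) (Ioc 0 1) := by
  have h1 : IntervalIntegrable (fun w : ℝ => w ^ s) volume 0 1 :=
    intervalIntegral.intervalIntegrable_rpow' hs
  have h2 : IntervalIntegrable (fun w : ℝ => (1 - w) ^ s) volume 0 1 := by
    have := (h1.comp_sub_left 1).symm
    simpa using this
  have h3 := (intervalIntegrable_iff_integrableOn_Ioo_of_le zero_le_one).1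
    ((h1.add h2).const_mul (2 ^ s))
  rw [integrableOn_Ioc_iff_integrableOn_Ioo]
  refine MeasureTheory.Integrable.mono' h3 ?_ ?_
  · exact Measurable.aestronglyMeasurable (by fun_prop)
  · filter_upwards [ae_restrict_mem measurableSet_Ioo] with w hw
    have hw1 : 0 < 1 - w := sub_pos.2 hw.2
    have key : ∀ {v : ℝ}, 0 < v → v ≤ 1 / 2 → sin (π * v) ^ s ≤ 2 ^ s * v ^ s := by
      intro v hv hv2
      rw [← mul_rpow zero_le_two hv.le]
      refine rpow_le_rpow_of_nonpos (by positivity) ?_ hs0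
      have := Real.mul_le_sin (x := π * v) (by positivity) (by nlinarith [pi_pos])
      rwa [← mul_assoc, div_mul_cancel₀ _ pi_ne_zero] at this
    have hsin : 0 < sin (π * w) := sin_pos_of_pos_of_lt_pi (mul_pos pi_pos hw.1)
      (by nlinarith [pi_pos, hw.2])
    have p1 : 0 < (2:ℝ) ^ s * w ^ s := mul_pos (rpow_pos_of_pos two_pos _) (rpow_pos_of_pos hw.1 _)
    have p2 : 0 < (2:ℝ) ^ s * (1 - w) ^ s :=
      mul_pos (rpow_pos_of_pos two_pos _) (rpow_pos_of_pos hw1 _)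
    rw [norm_of_nonneg (by positivity), mul_add]
    rcases le_total w (1 / 2) with h | h
    · linarith [key hw.1 h]
    · have := key hw1 (by linarith)
      rw [show π * (1 - w) = π - π * w by ring, sin_pi_sub] at this
      linarith

namespace ClosedCurve

variable {n : ℕ} {γ : ClosedCurve n}

theorem IsInj.isCircle_iff (hinj : γ.IsInj) (harc : γ.IsArclength) :
    IsCircle (range γ.toFun) ↔ γ.IsUnitSpeedCircle :=
  ⟨hinj.isUnitSpeedCircle harc, IsUnitSpeedCircle.isCircle⟩

/-- The lower bound for `Gw` in `ofReal_le_Gw`. -/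
def lowerBound (p q : ℝ) (γ : ClosedCurve n) (w : ℝ) : ℝ :=
  π ^ (p - q) * sin (π * w) ^ (2 * q - p) *
      (1 + (p - 2 * q) / 2 * (1 - γ.chordSq w / (sin (π * w) ^ 2 / π ^ 2)))

theorem IsArclength.le_lowerBound (harc : γ.IsArclength) {p q : ℝ} (hp1 : 2 * q < p) {w : ℝ}
    (hw : 0 < sin (π * w)) :
    π ^ (p - q) * sin (π * w) ^ (2 * q - p) ≤ γ.lowerBound p q w := by
  refine le_mul_of_one_le_right (by positivity) ?_
  have h1 : γ.chordSq w / (sin (π * w) ^ 2 / π ^ 2) ≤ 1 :=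
    (div_le_one (by positivity)).2 (harc.chordSq_le w)
  nlinarith

theorem IsArclength.lt_lowerBound (harc : γ.IsArclength) {p q : ℝ} (hp1 : 2 * q < p) {w : ℝ}
    (hw : 0 < sin (π * w)) (h : ¬ γ.IsUnitSpeedCircle) :
    π ^ (p - q) * sin (π * w) ^ (2 * q - p) < γ.lowerBound p q w := by
  refine lt_mul_of_one_lt_right (by positivity) ?_
  have h1 : γ.chordSq w / (sin (π * w) ^ 2 / π ^ 2) < 1 := by
    rw [div_lt_one (by positivity)]
    by_contra! hle
    obtain ⟨c, a, b, htrig⟩ := harc.exists_trig_of_le_chordSq hw.ne' hle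
    exact h (harc.isUnitSpeedCircle htrig)
  nlinarith

theorem IsArclength.measurable_lowerBound (harc : γ.IsArclength) (p q : ℝ) :
    Measurable (γ.lowerBound p q) := by
  have := harc.continuous_chordSq.measurable
  unfold lowerBound
  fun_prop

end ClosedCurve

/-- **Lower bound for `G^{(p,q)}_w` in the regime `p ∈ (2q, 4q−2]`** (Lemma 5.5):
`G^{(p,q)}_w(γ) ≥ π^{p−q} sin(πw)^{2q−p}` for every `w ∈ (0,1)`, and for `p < 2q+1`
also `G^{(p,q)}(γ) ≥ π^{p−q} ∫₀¹ sin(πw)^{2q−p} dw`; equality holds (in either) iff the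
image of `γ` is a circle. -/
theorem Gw_lower_bound {n : ℕ} (p q : ℝ) (hq : 1 < q) (hp1 : 2 * q < p)
    (hp2 : p ≤ 4 * q - 2) (γ : ClosedCurve n) (hinj : γ.IsInj) (harc : γ.IsArclength) :
    (∀ w ∈ Set.Ioo (0:ℝ) 1,
      ENNReal.ofReal (π ^ (p - q) * Real.sin (π * w) ^ (2 * q - p)) ≤ Gw p q γ w ∧
      (Gw p q γ w = ENNReal.ofReal (π ^ (p - q) * Real.sin (π * w) ^ (2 * q - p)) ↔
        IsCircle (Set.range γ.toFun))) ∧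
    (p < 2 * q + 1 →
      ENNReal.ofReal (π ^ (p - q) * ∫ w in (0:ℝ)..1, Real.sin (π * w) ^ (2 * q - p))
          ≤ G p q γ ∧
      (G p q γ =
          ENNReal.ofReal (π ^ (p - q) * ∫ w in (0:ℝ)..1, Real.sin (π * w) ^ (2 * q - p)) ↔
        IsCircle (Set.range γ.toFun))) := by

  have hsin : ∀ w ∈ Ioo (0:ℝ) 1, 0 < sin (π * w) := fun w hw =>
    sin_pos_of_pos_of_lt_pi (mul_pos pi_pos hw.1) (by nlinarith [pi_pos, hw.2])
  rw [hinj.isCircle_iff harc]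
  refine ⟨fun w hw => ⟨?_, fun h => ?_, fun h => h.Gw_eq hw p q⟩, fun hp3 => ?_⟩
  · exact (ENNReal.ofReal_le_ofReal (harc.le_lowerBound hp1 (hsin w hw))).trans
      (ClosedCurve.ofReal_le_Gw hq hp1 hp2 hinj harc hw)
  · by_contra hne
    have h1 := harc.lt_lowerBound hp1 (hsin w hw) hne
    have h2 := ClosedCurve.ofReal_le_Gw hq hp1 hp2 hinj harc hw
    have h3 := hsin w hw
    exact (h2.trans_eq h).not_gt ((ENNReal.ofReal_lt_ofReal_iff_of_nonneg (by positivity)).2 h1)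
  have hint : ENNReal.ofReal (π ^ (p - q) * ∫ w in (0:ℝ)..1, sin (π * w) ^ (2 * q - p)) =
      ∫⁻ w in Ioc (0:ℝ) 1, ENNReal.ofReal (π ^ (p - q) * sin (π * w) ^ (2 * q - p)) := by
    rw [← intervalIntegral.integral_const_mul, integral_of_le zero_le_one]
    refine ofReal_integral_eq_lintegral_ofReal
      ((integrableOn_sin_pi_mul_rpow (by linarith) (by linarith)).const_mul _) ?_
    filter_upwards [ae_restrict_mem measurableSet_Ioc] with w hw
    have : 0 ≤ sin (π * w) := sin_nonneg_of_nonneg_of_le_pi (mul_nonneg pi_pos.le hw.1.le)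
      (by nlinarith [pi_pos, hw.2])
    positivity
  have hae : ∀ᵐ w ∂volume.restrict (Ioc (0:ℝ) 1), w ∈ Ioo (0:ℝ) 1 := by
    filter_upwards [ae_restrict_mem measurableSet_Ioc, ae_restrict_of_ae (volume.ae_ne (1:ℝ))]
      with w h1 h2 using ⟨h1.1, h1.2.lt_of_ne h2⟩
  have hlow : ∫⁻ w in Ioc (0:ℝ) 1, ENNReal.ofReal (γ.lowerBound p q w) ≤ G p q γ :=
    lintegral_mono_ae (by
      filter_upwards [hae] with w hw using ClosedCurve.ofReal_le_Gw hq hp1 hp2 hinj harc hw)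
  refine ⟨?_, fun h => ?_, fun h => ?_⟩
  · rw [hint]
    refine le_trans (lintegral_mono_ae ?_) hlow
    filter_upwards [hae] with w hw
    exact ENNReal.ofReal_le_ofReal (harc.le_lowerBound hp1 (hsin w hw))
  · by_contra hne
    refine (hlow.trans_eq h).not_gt ?_
    rw [hint]
    refine lintegral_strict_mono ?_ (harc.measurable_lowerBound p q).ennreal_ofReal.aemeasurable
      (hint ▸ ENNReal.ofReal_ne_top) ?_
    · simp
    · filter_upwards [hae] with w hw
      have h3 := hsin w hw
      exact (ENNReal.ofReal_lt_ofReal_iff_of_nonneg (by positivity)).2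
        (harc.lt_lowerBound hp1 h3 hne)
  · rw [hint]
    refine lintegral_congr_ae ?_
    filter_upwards [hae] with w hw using h.Gw_eq hw p q

end
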